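/- Consider the power network η̇ = Dᵀω, Mω̇ = u − DΓ(V)sin(η) − Aω − P^l(t), TV̇ = −E(η)V + Ē_fd with demand P^l(t) = Π₁σ₁ + Q⁻¹1ₙR₂σ₂(t) + R̄₃σ₃(t), where Π₁ is diagonal constant, σ̇₂ = S₂σ₂ with S₂ skew-symmetric and invertible, σ₃ = (σ₃₁,…,σ₃ₙ) with σ̇₃ᵢ = S₃ᵢσ₃ᵢ, each S₃ᵢ skew-symmetric and invertible, R̄₃ = blockdiag(R₃₁,…,R₃ₙ), and for every i the pair ((R₂ R₃ᵢ), blockdiag(S₂, S₃ᵢ)) is observable. The controllers at the nodes are θ̇₁ᵢ = Σ_{j ∈ N_i^{comm}}(θ₁ⱼ − θ₁ᵢ) − qᵢ⁻¹ωᵢ, θ̇₂ᵢ = S₂θ₂ᵢ − qᵢ⁻¹R₂ᵀωᵢ, θ̇₃ᵢ = S₃ᵢθ₃ᵢ − R₃ᵢᵀωᵢ, uᵢ = qᵢ⁻¹θ₁ᵢ + qᵢ⁻¹R₂θ₂ᵢ + R₃ᵢθ₃ᵢ, with a connected communication graph and Q = diag(q₁,…,qₙ) positive definite. Suppose the regulator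 equations admit a solution (η̄, V̄) with η̄ ∈ range(Dᵀ) ∩ (−π/2, π/2)^m, V̄ positive, E(η̄)V̄ = Ē_fd, and E(η̄) − diag(V̄)⁻¹|D|Γ(V̄)diag(sin(η̄))diag(cos(η̄))⁻¹diag(sin(η̄))|D|ᵀdiag(V̄)⁻¹ positive definite, where the steady-state feedforward is ū(t) = Q⁻¹(1ₙ1ₙᵀ(Π₁σ₁))/(1ₙᵀQ⁻¹1ₙ) + Q⁻¹1ₙR₂σ₂(t) + R̄₃σ₃(t) with DΓ(V̄)sin(η̄) = ū(t) − P^l(t) constant. Then solutions of the closed loop starting sufficiently close to the steady state satisfy ω(t) → 0 and u(t) − ū(t) → 0 as t → ∞. -/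

import Mathlib

open Matrix Real Filter Topology Set

noncomputable section

/-- `Vec n` is `ℝⁿ`. -/
abbrev Vec (n : ℕ) := Fin n → ℝ

/-- Incidence matrix of the (undirected, arbitrarily oriented) graph whose `m` edges have
endpoints `ep1 k` (positive end) and `ep2 k` (negative end). -/
def incD {n m : ℕ} (ep1 ep2 : Fin m → Fin n) : Matrix (Fin n) (Fin m) ℝ :=
  Matrix.of fun i k => if i = ep1 k then 1 else if i = ep2 k then -1 else 0

/-- `Γ(V) = diag(γ₁,…,γ_m)`, `γ_k = V_i V_j B_{ij}` for edge `k = {i,j}`. -/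
def Gam {n m : ℕ} (ep1 ep2 : Fin m → Fin n) (B : Fin m → ℝ) (V : Vec n) :
    Matrix (Fin m) (Fin m) ℝ :=
  Matrix.diagonal fun k => V (ep1 k) * V (ep2 k) * B k

/-- The matrix `E(η)`. -/
def Emat {n m : ℕ} (ep1 ep2 : Fin m → Fin n) (B : Fin m → ℝ)
    (Bii Xd Xd' : Vec n) (η : Vec m) : Matrix (Fin n) (Fin n) ℝ :=
  Matrix.of fun i j =>
    if i = j then (1 - Bii i * (Xd i - Xd' i)) / (Xd i - Xd' i)
    else -∑ k, (if (ep1 k = i ∧ ep2 k = j) ∨ (ep1 k = j ∧ ep2 k = i)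
      then B k * Real.cos (η k) else 0)

/-- The diagonal matrix `F`. -/
def Fmat {n : ℕ} (Bii Xd Xd' : Vec n) : Matrix (Fin n) (Fin n) ℝ :=
  Matrix.diagonal fun i => (1 - Bii i * (Xd i - Xd' i)) / (Xd i - Xd' i)

/-- componentwise sine -/
def sinv {m : ℕ} (η : Vec m) : Vec m := fun k => Real.sin (η k)
/-- componentwise cosine -/
def cosv {m : ℕ} (η : Vec m) : Vec m := fun k => Real.cos (η k)

/-- The storage function `W₂` with reference point `(ηb, Vb)`. -/
def W2 {n m : ℕ} (ep1 ep2 : Fin m → Fin n) (B : Fin m → ℝ) (Bii Xd Xd' : Vec n)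
    (Efd : Vec n) (ηb : Vec m) (Vb : Vec n) (η : Vec m) (V : Vec n) : ℝ :=
  -((1 : Vec m) ⬝ᵥ (Gam ep1 ep2 B V).mulVec (cosv η))
    + (1 : Vec m) ⬝ᵥ (Gam ep1 ep2 B Vb).mulVec (cosv ηb)
    - ((Gam ep1 ep2 B Vb).mulVec (sinv ηb)) ⬝ᵥ (η - ηb)
    - Efd ⬝ᵥ (V - Vb)
    + (1 / 2) * (V ⬝ᵥ (Fmat Bii Xd Xd').mulVec V)
    - (1 / 2) * (Vb ⬝ᵥ (Fmat Bii Xd Xd').mulVec Vb)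

/-- entrywise absolute value `|D|` of the incidence matrix. -/
def absD {n m : ℕ} (ep1 ep2 : Fin m → Fin n) : Matrix (Fin n) (Fin m) ℝ :=
  Matrix.of fun i k => |incD ep1 ep2 i k|

/-- The matrix `E(η̄) − diag(V̄)⁻¹|D|Γ(V̄)diag(sin η̄)diag(cos η̄)⁻¹diag(sin η̄)|D|ᵀdiag(V̄)⁻¹`
appearing in Assumption 3. -/
def Schur {n m : ℕ} (ep1 ep2 : Fin m → Fin n) (B : Fin m → ℝ) (Bii Xd Xd' : Vec n)
    (ηb : Vec m) (Vb : Vec n) : Matrix (Fin n) (Fin n) ℝ :=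
  Emat ep1 ep2 B Bii Xd Xd' ηb -
    (Matrix.diagonal fun i => (Vb i)⁻¹) * absD ep1 ep2 * Gam ep1 ep2 B Vb *
      Matrix.diagonal (sinv ηb) * (Matrix.diagonal (cosv ηb))⁻¹ *
      Matrix.diagonal (sinv ηb) * (absD ep1 ep2)ᵀ * (Matrix.diagonal fun i => (Vb i)⁻¹)

/-! ### Bounded Lipschitz functions on the half line -/

/-- `f` is bounded on `[0, ∞)`. -/
def BddNonneg (f : ℝ → ℝ) : Prop := ∃ C, ∀ t, 0 ≤ t → |f t| ≤ C

/-- `f` is Lipschitz on `[0, ∞)`. -/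
def LipNonneg (f : ℝ → ℝ) : Prop :=
  ∃ C, ∀ s t, 0 ≤ s → 0 ≤ t → |f s - f t| ≤ C * |s - t|

namespace BddNonneg

lemma const (c : ℝ) : BddNonneg fun _ => c := ⟨|c|, fun _ _ => le_rfl⟩

lemma add {f g : ℝ → ℝ} (hf : BddNonneg f) (hg : BddNonneg g) :
    BddNonneg fun t => f t + g t := by
  obtain ⟨C, hC⟩ := hf
  obtain ⟨D, hD⟩ := hg
  exact ⟨C + D, fun t ht => (abs_add_le _ _).trans (add_le_add (hC t ht) (hD t ht))⟩

lemma mul {f g : ℝ → ℝ} (hf : BddNonneg f) (hg : BddNonneg g) :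
    BddNonneg fun t => f t * g t := by
  obtain ⟨C, hC⟩ := hf
  obtain ⟨D, hD⟩ := hg
  refine ⟨C * D, fun t ht => ?_⟩
  rw [abs_mul]
  exact mul_le_mul (hC t ht) (hD t ht) (abs_nonneg _) ((abs_nonneg _).trans (hC t ht))

lemma sub {f g : ℝ → ℝ} (hf : BddNonneg f) (hg : BddNonneg g) :
    BddNonneg fun t => f t - g t := by
  simpa [sub_eq_add_neg] using hf.add ((const (-1)).mul hg)

lemma sum {ι : Type*} {s : Finset ι} {f : ι → ℝ → ℝ} (hf : ∀ i ∈ s, BddNonneg (f i)) :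
    BddNonneg fun t => ∑ i ∈ s, f i t := by
  classical
  induction s using Finset.induction_on with
  | empty => simpa using const 0
  | insert i s hi ih =>
    simp only [Finset.sum_insert hi]
    exact (hf i (by simp)).add (ih fun j hj => hf j (by simp [hj]))

lemma sin (f : ℝ → ℝ) : BddNonneg fun t => Real.sin (f t) :=
  ⟨1, fun _ _ => Real.abs_sin_le_one _⟩

lemma cos (f : ℝ → ℝ) : BddNonneg fun t => Real.cos (f t) :=
  ⟨1, fun _ _ => Real.abs_cos_le_one _⟩

lemma lipNonneg {f f' : ℝ → ℝ} (h : ∀ t, HasDerivAt f (f' t) t) (hf : BddNonneg f') :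
    LipNonneg f := by
  obtain ⟨C, hC⟩ := hf
  refine ⟨C, fun s t hs ht => ?_⟩
  exact (convex_Ici (0 : ℝ)).norm_image_sub_le_of_norm_hasDerivWithin_le
    (fun x _ => (h x).hasDerivWithinAt) (fun x hx => hC x hx) ht hs

end BddNonneg

/-- A function on `[0, ∞)` that is both bounded and Lipschitz. -/
def BddLip (f : ℝ → ℝ) : Prop := BddNonneg f ∧ LipNonneg f

namespace BddLip

lemma of_deriv {f f' : ℝ → ℝ} (hf : BddNonneg f) (h : ∀ t, HasDerivAt f (f' t) t)
    (hf' : BddNonneg f') : BddLip f := ⟨hf, hf'.lipNonneg h⟩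

lemma const (c : ℝ) : BddLip fun _ => c := ⟨.const c, 0, by simp⟩

lemma add {f g : ℝ → ℝ} (hf : BddLip f) (hg : BddLip g) : BddLip fun t => f t + g t := by
  obtain ⟨hf, C, hC⟩ := hf
  obtain ⟨hg, D, hD⟩ := hg
  refine ⟨hf.add hg, C + D, fun s t hs ht => ?_⟩
  calc |f s + g s - (f t + g t)| = |(f s - f t) + (g s - g t)| := by congr 1; ring
    _ ≤ C * |s - t| + D * |s - t| :=
      (abs_add_le _ _).trans (add_le_add (hC s t hs ht) (hD s t hs ht))
    _ = _ := by ring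

lemma mul {f g : ℝ → ℝ} (hf : BddLip f) (hg : BddLip g) : BddLip fun t => f t * g t := by
  obtain ⟨⟨a, ha⟩, C, hC⟩ := id hf
  obtain ⟨⟨b, hb⟩, D, hD⟩ := id hg
  refine ⟨hf.1.mul hg.1, a * D + C * b, fun s t hs ht => ?_⟩
  calc |f s * g s - f t * g t| = |f s * (g s - g t) + (f s - f t) * g t| := by congr 1; ring
    _ ≤ |f s| * |g s - g t| + |f s - f t| * |g t| := by
      rw [← abs_mul, ← abs_mul]; exact abs_add_le _ _
    _ ≤ a * (D * |s - t|) + C * |s - t| * b :=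
      add_le_add
        (mul_le_mul (ha s hs) (hD s t hs ht) (abs_nonneg _) ((abs_nonneg _).trans (ha s hs)))
        (mul_le_mul (hC s t hs ht) (hb t ht) (abs_nonneg _)
          ((abs_nonneg _).trans (hC s t hs ht)))
    _ = _ := by ring

lemma sub {f g : ℝ → ℝ} (hf : BddLip f) (hg : BddLip g) : BddLip fun t => f t - g t := by
  simpa [sub_eq_add_neg] using hf.add ((const (-1)).mul hg)

lemma sum {ι : Type*} {s : Finset ι} {f : ι → ℝ → ℝ} (hf : ∀ i ∈ s, BddLip (f i)) :
    BddLip fun t => ∑ i ∈ s, f i t := by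
  classical
  induction s using Finset.induction_on with
  | empty => simpa using const 0
  | insert i s hi ih =>
    simp only [Finset.sum_insert hi]
    exact (hf i (by simp)).add (ih fun j hj => hf j (by simp [hj]))

lemma sin {f : ℝ → ℝ} (hf : LipNonneg f) : BddLip fun t => Real.sin (f t) := by
  obtain ⟨C, hC⟩ := hf
  exact ⟨.sin f, C, fun s t hs ht => (Real.abs_sin_sub_sin_le _ _).trans (hC s t hs ht)⟩

lemma cos {f : ℝ → ℝ} (hf : LipNonneg f) : BddLip fun t => Real.cos (f t) := by
  obtain ⟨C, hC⟩ := hf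
  exact ⟨.cos f, C, fun s t hs ht => (Real.abs_cos_sub_cos_le _ _).trans (hC s t hs ht)⟩

end BddLip

lemma BddNonneg.tendsto_mul_zero {f g : ℝ → ℝ} (hf : BddNonneg f) (hg : Tendsto g atTop (𝓝 0)) :
    Tendsto (fun t => f t * g t) atTop (𝓝 0) := by
  obtain ⟨C, hC⟩ := hf
  have h : Tendsto (fun t => C * |g t|) atTop (𝓝 0) := by simpa using hg.abs.const_mul C
  refine squeeze_zero_norm' ?_ h
  filter_upwards [eventually_ge_atTop 0] with t ht
  rw [Real.norm_eq_abs, abs_mul]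
  exact mul_le_mul_of_nonneg_right (hC t ht) (abs_nonneg _)

lemma bddNonneg_of_sq_le {f : ℝ → ℝ} {a C : ℝ} (ha : 0 < a)
    (hf : ∀ t, 0 ≤ t → a * f t ^ 2 ≤ C) : BddNonneg f :=
  ⟨√(C / a), fun t ht => Real.abs_le_sqrt ((le_div_iff₀' ha).2 (hf t ht))⟩

lemma tendsto_zero_of_sq_le {f d : ℝ → ℝ} {a : ℝ} (ha : 0 < a)
    (hd : Tendsto d atTop (𝓝 0)) (hf : ∀ t, a * f t ^ 2 ≤ d t) : Tendsto f atTop (𝓝 0) := by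
  have h1 : Tendsto (fun t => f t ^ 2) atTop (𝓝 0) := by
    refine squeeze_zero (fun t => sq_nonneg _) (fun t => (le_div_iff₀' ha).2 (hf t)) ?_
    simpa using hd.div_const a
  have h2 := h1.sqrt
  simp only [Real.sqrt_sq_eq_abs, Real.sqrt_zero] at h2
  exact (tendsto_zero_iff_abs_tendsto_zero f).2 h2

/-- A variant of Barbalat's lemma: if `f` converges and its derivative is the sum of a Lipschitz
function `g` and a vanishing function, then `g` vanishes at infinity. -/
lemma LipNonneg.tendsto_zero {f g h : ℝ → ℝ} {l : ℝ} (hg : LipNonneg g)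
    (hf : Tendsto f atTop (𝓝 l)) (hder : ∀ t, HasDerivAt f (g t + h t) t)
    (hh : Tendsto h atTop (𝓝 0)) : Tendsto g atTop (𝓝 0) := by
  obtain ⟨K, hK⟩ := hg
  have hK0 : 0 ≤ K := by
    have := (abs_nonneg _).trans (hK 1 0 zero_le_one le_rfl)
    simpa using this
  rw [Metric.tendsto_atTop]
  intro ε hε
  set δ := ε / (4 * (K + 1)) with hδ
  have hδ0 : 0 < δ := by positivity
  have hKδ : K * δ ≤ ε / 4 := by
    rw [hδ, ← mul_div_assoc, div_le_div_iff₀ (by positivity) (by positivity)]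
    nlinarith
  obtain ⟨T₁, hT₁⟩ := Metric.tendsto_atTop.1 hh (ε / 4) (by positivity)
  obtain ⟨T₂, hT₂⟩ := Metric.tendsto_atTop.1 hf (ε * δ / 8) (by positivity)
  refine ⟨max 0 (max T₁ T₂), fun t ht => ?_⟩
  have ht0 : 0 ≤ t := (le_max_left _ _).trans ht
  have ht1 : T₁ ≤ t := (le_max_left _ _).trans ((le_max_right _ _).trans ht)
  have ht2 : T₂ ≤ t := (le_max_right _ _).trans ((le_max_right _ _).trans ht)
  obtain ⟨ξ, ⟨hξ1, hξ2⟩, hξ⟩ := exists_hasDerivAt_eq_slope f (fun t => g t + h t)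
    (show t < t + δ by linarith) (fun x _ => (hder x).continuousAt.continuousWithinAt)
    (fun x _ => hder x)
  have e1 := hT₂ t ht2
  have e2 := hT₂ (t + δ) (by linarith)
  have e3 := hT₁ ξ (by linarith)
  have e4 := hK t ξ ht0 (by linarith)
  rw [Real.dist_eq] at e1 e2 e3 ⊢
  rw [sub_zero] at e3 ⊢
  have e5 : |t - ξ| ≤ δ := by rw [abs_le]; constructor <;> linarith
  have e6 : |g t - g ξ| ≤ ε / 4 := e4.trans ((mul_le_mul_of_nonneg_left e5 hK0).trans hKδ)
  rw [add_sub_cancel_left, eq_div_iff hδ0.ne'] at hξ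
  have e7 : |g ξ + h ξ| * δ < ε / 4 * δ := by
    rw [← abs_of_pos hδ0, ← abs_mul, abs_of_pos hδ0, hξ]
    rw [abs_lt] at e1 e2 ⊢
    constructor <;> linarith
  have e8 := lt_of_mul_lt_mul_right e7 hδ0.le
  rw [abs_lt] at *
  rw [abs_le] at e6
  constructor <;> linarith

/-- A continuous function that is homogeneous of degree two and positive away from `0` dominates
a multiple of the square of the norm. -/
lemma exists_pos_mul_sq_norm_le {E : Type*} [NormedAddCommGroup E] [NormedSpace ℝ E]
    [ProperSpace E] {Q : E → ℝ} (hc : Continuous Q) (hs : ∀ (s : ℝ) x, Q (s • x) = s ^ 2 * Q x)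
    (hpos : ∀ x, x ≠ 0 → 0 < Q x) : ∃ c > 0, ∀ x, c * ‖x‖ ^ 2 ≤ Q x := by
  have h0 : Q 0 = 0 := by simpa using hs 0 0
  rcases (Metric.sphere (0 : E) 1).eq_empty_or_nonempty with he | hne
  · refine ⟨1, one_pos, fun x => ?_⟩
    rcases eq_or_ne x 0 with rfl | hx
    · simp [h0]
    · have : ‖x‖⁻¹ • x ∈ Metric.sphere (0 : E) 1 := by simp [norm_smul, hx]
      simp [he] at this
  · obtain ⟨y, hy, hmin⟩ := (isCompact_sphere (0 : E) 1).exists_isMinOn hne hc.continuousOn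
    have hy0 : y ≠ 0 := by rintro rfl; simp at hy
    refine ⟨Q y, hpos y hy0, fun x => ?_⟩
    rcases eq_or_ne x 0 with rfl | hx
    · simp [h0]
    · have hx' : 0 < ‖x‖ := norm_pos_iff.2 hx
      have hmem : ‖x‖⁻¹ • x ∈ Metric.sphere (0 : E) 1 := by simp [norm_smul, hx]
      have h1 : Q y ≤ Q (‖x‖⁻¹ • x) := hmin hmem
      rw [hs, inv_pow, ← div_eq_inv_mul, le_div_iff₀ (by positivity)] at h1
      exact h1

lemma abs_cos_add_sub_le (a : ℝ) {x r : ℝ} (hx : |x| ≤ r) :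
    |cos (a + x) - cos a| ≤ r := by
  simpa using (Real.abs_cos_sub_cos_le (a + x) a).trans (by simpa using hx)

lemma abs_sin_sub_self_le {x r : ℝ} (hx : |x| ≤ r) (hr : r ≤ 1) :
    |sin x - x| ≤ r ^ 3 / 4 ∧ |cos x - 1 + x ^ 2 / 2| ≤ r ^ 3 / 4 := by
  have h1 := Real.sin_bound (hx.trans hr)
  have h2 := Real.cos_bound (hx.trans hr)
  have h0 : 0 ≤ r := (abs_nonneg x).trans hx
  have h3 : |x| ^ 3 ≤ r ^ 3 := pow_le_pow_left₀ (abs_nonneg x) hx 3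
  have h4 : |x| ^ 4 ≤ r ^ 3 :=
    (pow_le_pow_left₀ (abs_nonneg x) hx 4).trans (pow_le_pow_of_le_one h0 hr (by norm_num))
  have h7 : |x| ^ 5 ≤ r ^ 3 :=
    (pow_le_pow_left₀ (abs_nonneg x) hx 5).trans (pow_le_pow_of_le_one h0 hr (by norm_num))
  have h5 : |x ^ 3| ≤ r ^ 3 := by rwa [abs_pow]
  have h6 : 0 ≤ r ^ 3 := by positivity
  rw [abs_le] at *
  refine ⟨⟨?_, ?_⟩, abs_le.2 ⟨?_, ?_⟩⟩ <;> linarith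

lemma abs_cos_add_sub_second_order_le (a : ℝ) {x r : ℝ} (hx : |x| ≤ r) (hr : r ≤ 1) :
    |cos (a + x) - cos a + sin a * x + cos a * x ^ 2 / 2| ≤ r ^ 3 := by
  obtain ⟨h1, h2⟩ := abs_sin_sub_self_le hx hr
  have h0 : 0 ≤ r := (abs_nonneg x).trans hx
  have e : cos (a + x) - cos a + sin a * x + cos a * x ^ 2 / 2
      = cos a * (cos x - 1 + x ^ 2 / 2) - sin a * (sin x - x) := by rw [cos_add]; ring
  rw [e]
  calc _ ≤ |cos a| * |cos x - 1 + x ^ 2 / 2| + |sin a| * |sin x - x| := by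
        rw [← abs_mul, ← abs_mul]; exact abs_sub _ _
    _ ≤ 1 * (r ^ 3 / 4) + 1 * (r ^ 3 / 4) := by
        gcongr
        · exact Real.abs_cos_le_one a
        · exact Real.abs_sin_le_one a
    _ ≤ r ^ 3 := by nlinarith [pow_nonneg h0 3]

lemma abs_cos_add_sub_first_order_le (a : ℝ) {x r : ℝ} (hx : |x| ≤ r) (hr : r ≤ 1) :
    |cos (a + x) - cos a + sin a * x| ≤ 2 * r ^ 2 := by
  have h := abs_cos_add_sub_second_order_le a hx hr
  have h0 : 0 ≤ r := (abs_nonneg x).trans hx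
  have h3 : r ^ 3 ≤ r ^ 2 := pow_le_pow_of_le_one h0 hr (by norm_num)
  have h4 : |cos a * x ^ 2| ≤ r ^ 2 := by
    rw [abs_mul, abs_pow]
    calc _ ≤ 1 * r ^ 2 := by gcongr; exact Real.abs_cos_le_one a
      _ = _ := one_mul _
  rw [abs_le] at *
  constructor <;> linarith

/-! ### The energy of the grid -/

/-- The electrical part of a power network with nodes `N` and lines `K`: end points and
susceptances of the lines, and self-interaction coefficients of the nodes. -/
structure Grid (N K : Type*) where
  /-- the positive end of a line -/
  src : K → N
  /-- the negative end of a line -/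
  tgt : K → N
  /-- the susceptance of a line -/
  susc : K → ℝ
  /-- the self-interaction coefficient of a node -/
  self : N → ℝ

namespace Grid

variable {N K : Type*} [Fintype N] [Fintype K] [DecidableEq N] (g : Grid N K)

/-- Entries of the incidence matrix. -/
def inc (i : N) (k : K) : ℝ := if i = g.src k then 1 else if i = g.tgt k then -1 else 0

/-- The active power transported by a line. -/
def flow (η : K → ℝ) (V : N → ℝ) (k : K) : ℝ := V (g.src k) * V (g.tgt k) * g.susc k * sin (η k)

/-- The voltage at the other end of `k`, as seen from `i`; zero if `i` is not an end of `k`. -/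
def opposite (V : N → ℝ) (i : N) (k : K) : ℝ :=
  (if i = g.src k then V (g.tgt k) else 0) + (if i = g.tgt k then V (g.src k) else 0)

/-- The vector `E(η) V`. -/
def current (η : K → ℝ) (V : N → ℝ) (i : N) : ℝ :=
  g.self i * V i - ∑ k, g.opposite V i k * (g.susc k * cos (η k))

/-- The electrical energy. -/
def energy (η : K → ℝ) (V : N → ℝ) : ℝ :=
  1 / 2 * ∑ i, g.self i * V i ^ 2 - ∑ k, V (g.src k) * V (g.tgt k) * (g.susc k * cos (η k))

/-- The Bregman divergence of the electrical energy with reference point `(ηb, Vb)`. -/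
def divergence (ηb : K → ℝ) (Vb : N → ℝ) (η : K → ℝ) (V : N → ℝ) : ℝ :=
  g.energy η V - g.energy ηb Vb - ∑ k, g.flow ηb Vb k * (η k - ηb k)
    - ∑ i, g.current ηb Vb i * (V i - Vb i)

/-- The quadratic part of the divergence. -/
def hessian (ηb : K → ℝ) (Vb : N → ℝ) (x : K → ℝ) (v : N → ℝ) : ℝ :=
  1 / 2 * ∑ i, g.self i * v i ^ 2 + ∑ k, g.susc k *
    (Vb (g.src k) * Vb (g.tgt k) * cos (ηb k) * x k ^ 2 / 2
      + sin (ηb k) * x k * (v (g.src k) * Vb (g.tgt k) + v (g.tgt k) * Vb (g.src k))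
      - v (g.src k) * v (g.tgt k) * cos (ηb k))

/-- The quadratic form of the Schur complement of the Hessian of the energy. -/
def schurForm (ηb : K → ℝ) (Vb : N → ℝ) (v : N → ℝ) : ℝ :=
  ∑ i, g.self i * v i ^ 2 - ∑ k, g.susc k *
    (2 * v (g.src k) * v (g.tgt k) * cos (ηb k)
      + Vb (g.src k) * Vb (g.tgt k) * (sin (ηb k) ^ 2 / cos (ηb k))
        * (v (g.src k) / Vb (g.src k) + v (g.tgt k) / Vb (g.tgt k)) ^ 2)

omit [Fintype K] in
variable {g} in
lemma sum_inc_mul (hne : ∀ k, g.src k ≠ g.tgt k) (f : N → ℝ) (k : K) :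
    ∑ i, g.inc i k * f i = f (g.src k) - f (g.tgt k) := by
  have h : ∀ i, g.inc i k * f i
      = (if i = g.src k then f i else 0) - (if i = g.tgt k then f i else 0) := by
    intro i
    unfold inc
    split_ifs with h1 h2 <;> first | exact absurd (h1.symm.trans h2) (hne k) | simp
  simp [h]

variable {g} in
lemma sum_mul_sum_inc (hne : ∀ k, g.src k ≠ g.tgt k) (f : N → ℝ) (h : K → ℝ) :
    ∑ i, f i * ∑ k, g.inc i k * h k = ∑ k, h k * (f (g.src k) - f (g.tgt k)) := by
  simp_rw [Finset.mul_sum]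
  rw [Finset.sum_comm]
  refine Finset.sum_congr rfl fun k _ => ?_
  rw [← sum_inc_mul hne, Finset.mul_sum]
  exact Finset.sum_congr rfl fun i _ => by ring

omit [Fintype K] in
lemma sum_opposite_mul (V f : N → ℝ) (k : K) :
    ∑ i, g.opposite V i k * f i = V (g.tgt k) * f (g.src k) + V (g.src k) * f (g.tgt k) := by
  simp [opposite, add_mul, Finset.sum_add_distrib]

lemma sum_current_mul (η : K → ℝ) (V f : N → ℝ) :
    ∑ i, g.current η V i * f i = ∑ i, g.self i * V i * f i - ∑ k, g.susc k * cos (η k) *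
      (V (g.tgt k) * f (g.src k) + V (g.src k) * f (g.tgt k)) := by
  have h : ∑ k, g.susc k * cos (η k) *
      (V (g.tgt k) * f (g.src k) + V (g.src k) * f (g.tgt k))
      = ∑ i, (∑ k, g.opposite V i k * (g.susc k * cos (η k))) * f i := by
    simp_rw [← sum_opposite_mul, Finset.mul_sum, Finset.sum_mul]
    rw [Finset.sum_comm]
    exact Finset.sum_congr rfl fun i _ => Finset.sum_congr rfl fun k _ => by ring
  rw [h, ← Finset.sum_sub_distrib]
  exact Finset.sum_congr rfl fun i _ => by rw [current]; ring

/-- The error of the quadratic approximation of the divergence. -/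
lemma divergence_sub_hessian (ηb : K → ℝ) (Vb : N → ℝ) (x : K → ℝ) (v : N → ℝ) :
    g.divergence ηb Vb (ηb + x) (Vb + v) - g.hessian ηb Vb x v = -∑ k, g.susc k *
      (v (g.src k) * v (g.tgt k) * (cos (ηb k + x k) - cos (ηb k))
        + (v (g.src k) * Vb (g.tgt k) + v (g.tgt k) * Vb (g.src k))
          * (cos (ηb k + x k) - cos (ηb k) + sin (ηb k) * x k)
        + Vb (g.src k) * Vb (g.tgt k) * (cos (ηb k + x k) - cos (ηb k) + sin (ηb k) * x k
          + cos (ηb k) * x k ^ 2 / 2)) := by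
  rw [divergence, sum_current_mul]
  simp only [energy, hessian, flow, Pi.add_apply, add_sub_cancel_left]
  have hN : 1 / 2 * ∑ i, g.self i * (Vb i + v i) ^ 2 - 1 / 2 * ∑ i, g.self i * Vb i ^ 2
      - ∑ i, g.self i * Vb i * v i - 1 / 2 * ∑ i, g.self i * v i ^ 2 = 0 := by
    simp only [Finset.mul_sum, ← Finset.sum_sub_distrib]
    exact Finset.sum_eq_zero fun i _ => by ring
  rw [← sub_eq_zero, ← hN, ← sub_eq_zero]
  ring_nf
  simp only [← Finset.sum_add_distrib, ← Finset.sum_sub_distrib, ← Finset.sum_neg_distrib]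
  exact Finset.sum_eq_zero fun i _ => by ring

omit [DecidableEq N] in
variable {g} in
lemma hessian_pos (hB : ∀ k, 0 < g.susc k) {ηb : K → ℝ} {Vb : N → ℝ} (hVb : ∀ i, 0 < Vb i)
    (hcos : ∀ k, 0 < cos (ηb k)) (hschur : ∀ v, v ≠ 0 → 0 < g.schurForm ηb Vb v)
    {x : K → ℝ} {v : N → ℝ} (h : (x, v) ≠ 0) : 0 < g.hessian ηb Vb x v := by
  have hsq : g.hessian ηb Vb x v = 1 / 2 * g.schurForm ηb Vb v + ∑ k, g.susc k *
      (Vb (g.src k) * Vb (g.tgt k)) * cos (ηb k) / 2 * (x k + sin (ηb k) / cos (ηb k) *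
        (v (g.src k) / Vb (g.src k) + v (g.tgt k) / Vb (g.tgt k))) ^ 2 := by
    rw [hessian, schurForm, mul_sub, sub_add, Finset.mul_sum (s := Finset.univ (α := K)),
      ← Finset.sum_sub_distrib, sub_eq_add_neg, ← Finset.sum_neg_distrib]
    congr 1
    refine Finset.sum_congr rfl fun k _ => ?_
    have h1 := (hVb (g.src k)).ne'
    have h2 := (hVb (g.tgt k)).ne'
    have h3 := (hcos k).ne'
    field_simp
    ring
  have hw : ∀ k, 0 < g.susc k * (Vb (g.src k) * Vb (g.tgt k)) * cos (ηb k) / 2 := fun k => by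
    have := hB k; have := hVb (g.src k); have := hVb (g.tgt k); have := hcos k
    positivity
  rw [hsq]
  by_cases hv : v = 0
  · subst hv
    have hx : x ≠ 0 := fun hx => h (by simp [hx])
    obtain ⟨k, hk⟩ := Function.ne_iff.1 hx
    have : g.schurForm ηb Vb 0 = 0 := by simp [schurForm]
    rw [this, mul_zero, zero_add]
    refine Finset.sum_pos' (fun k _ => mul_nonneg (hw k).le (sq_nonneg _))
      ⟨k, Finset.mem_univ k, mul_pos (hw k) ?_⟩
    simpa using sq_pos_of_ne_zero hk
  · exact add_pos_of_pos_of_nonneg (mul_pos (by norm_num) (hschur v hv))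
      (Finset.sum_nonneg fun k _ => mul_nonneg (hw k).le (sq_nonneg _))

variable {g} in
lemma exists_le_divergence (hB : ∀ k, 0 < g.susc k) {ηb : K → ℝ} {Vb : N → ℝ}
    (hVb : ∀ i, 0 < Vb i) (hcos : ∀ k, 0 < cos (ηb k))
    (hschur : ∀ v, v ≠ 0 → 0 < g.schurForm ηb Vb v) :
    ∃ ρ > 0, ∃ c > 0, ∀ (x : K → ℝ) (v : N → ℝ), ‖(x, v)‖ ≤ ρ →
      c * ‖(x, v)‖ ^ 2 ≤ g.divergence ηb Vb (ηb + x) (Vb + v) := by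
  obtain ⟨c, hc0, hc⟩ := exists_pos_mul_sq_norm_le (E := (K → ℝ) × (N → ℝ))
    (Q := fun y => g.hessian ηb Vb y.1 y.2) (by unfold hessian; fun_prop)
    (fun s y => by
      simp only [hessian, Prod.smul_fst, Prod.smul_snd, Pi.smul_apply, smul_eq_mul, mul_add,
        Finset.mul_sum]
      congr 1 <;> exact Finset.sum_congr rfl fun k _ => by ring)
    (fun y hy => hessian_pos hB hVb hcos hschur hy)
  set C : ℝ := ∑ k, g.susc k *
    (1 + 2 * (Vb (g.tgt k) + Vb (g.src k)) + Vb (g.src k) * Vb (g.tgt k)) with hC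
  have hC0 : 0 ≤ C := Finset.sum_nonneg fun k _ => by
    have := hB k; have := hVb (g.src k); have := hVb (g.tgt k)
    positivity
  refine ⟨min 1 (c / (2 * (C + 1))), by positivity, c / 2, by positivity, fun x v hxv => ?_⟩
  set r := ‖(x, v)‖ with hr
  have hr0 : 0 ≤ r := norm_nonneg _
  have hr1 : r ≤ 1 := hxv.trans (min_le_left _ _)
  have hrc : C * r ≤ c / 2 := by
    have h1 := hxv.trans (min_le_right _ _)
    rw [le_div_iff₀ (by positivity)] at h1
    nlinarith
  have hx : ∀ k, |x k| ≤ r := fun k => (norm_le_pi_norm x k).trans (norm_fst_le (x, v))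
  have hv : ∀ i, |v i| ≤ r := fun i => (norm_le_pi_norm v i).trans (norm_snd_le (x, v))
  have herr : |g.divergence ηb Vb (ηb + x) (Vb + v) - g.hessian ηb Vb x v| ≤ C * r ^ 3 := by
    rw [divergence_sub_hessian, abs_neg, hC, Finset.sum_mul]
    refine (Finset.abs_sum_le_sum_abs _ _).trans (Finset.sum_le_sum fun k _ => ?_)
    rw [abs_mul, abs_of_pos (hB k), mul_assoc (g.susc k) _ (r ^ 3)]
    refine mul_le_mul_of_nonneg_left ?_ (hB k).le
    have ha := hVb (g.src k)
    have hb := hVb (g.tgt k)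
    have h1 := abs_cos_add_sub_le (ηb k) (hx k)
    have h2 := abs_cos_add_sub_first_order_le (ηb k) (hx k) hr1
    have h3 := abs_cos_add_sub_second_order_le (ηb k) (hx k) hr1
    have hva := hv (g.src k)
    have hvb := hv (g.tgt k)
    refine (abs_add_three _ _ _).trans ?_
    have e1 : |v (g.src k) * v (g.tgt k) * (cos (ηb k + x k) - cos (ηb k))| ≤ r * r * r := by
      rw [abs_mul, abs_mul]; gcongr
    have e2 : |(v (g.src k) * Vb (g.tgt k) + v (g.tgt k) * Vb (g.src k))
        * (cos (ηb k + x k) - cos (ηb k) + sin (ηb k) * x k)|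
        ≤ (r * Vb (g.tgt k) + r * Vb (g.src k)) * (2 * r ^ 2) := by
      rw [abs_mul]
      gcongr
      refine (abs_add_le _ _).trans ?_
      rw [abs_mul, abs_mul, abs_of_pos ha, abs_of_pos hb]
      gcongr
    have e3 : |Vb (g.src k) * Vb (g.tgt k) * (cos (ηb k + x k) - cos (ηb k) + sin (ηb k) * x k
          + cos (ηb k) * x k ^ 2 / 2)| ≤ Vb (g.src k) * Vb (g.tgt k) * r ^ 3 := by
      rw [abs_mul, abs_of_pos (mul_pos ha hb)]
      gcongr
    linarith
  have h1 := hc (x, v)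
  have h2 : C * r ^ 3 ≤ c / 2 * r ^ 2 := by
    calc C * r ^ 3 = C * r * r ^ 2 := by ring
      _ ≤ _ := by gcongr
  have h3 := (abs_le.1 herr).1
  simp only [← hr] at h1
  linarith

lemma divergence_self (ηb : K → ℝ) (Vb : N → ℝ) : g.divergence ηb Vb ηb Vb = 0 := by
  simp [divergence]

lemma hasDerivAt_divergence (ηb : K → ℝ) (Vb : N → ℝ) {η : ℝ → K → ℝ} {η' : K → ℝ}
    {V : ℝ → N → ℝ} {V' : N → ℝ} {t : ℝ} (hη : ∀ k, HasDerivAt (fun t => η t k) (η' k) t)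
    (hV : ∀ i, HasDerivAt (fun t => V t i) (V' i) t) :
    HasDerivAt (fun t => g.divergence ηb Vb (η t) (V t))
      (∑ k, (g.flow (η t) (V t) k - g.flow ηb Vb k) * η' k
        + ∑ i, (g.current (η t) (V t) i - g.current ηb Vb i) * V' i) t := by
  have hsum : ∑ i, (g.current (η t) (V t) i - g.current ηb Vb i) * V' i
      = ∑ i, g.current (η t) (V t) i * V' i - ∑ i, g.current ηb Vb i * V' i := by
    simp [sub_mul, Finset.sum_sub_distrib]
  have h1 : HasDerivAt (fun t => 1 / 2 * ∑ i, g.self i * V t i ^ 2)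
      (∑ i, g.self i * V t i * V' i) t := by
    have := (HasDerivAt.fun_sum fun i (_ : i ∈ Finset.univ) =>
      ((hV i).fun_pow 2).const_mul (g.self i)).const_mul (1 / 2)
    refine this.congr_deriv ?_
    rw [Finset.mul_sum]
    exact Finset.sum_congr rfl fun i _ => by push_cast; ring
  have h2 : HasDerivAt
      (fun t => ∑ k, V t (g.src k) * V t (g.tgt k) * (g.susc k * cos (η t k))) _ t :=
    HasDerivAt.fun_sum fun k (_ : k ∈ Finset.univ) =>
      ((hV (g.src k)).mul (hV (g.tgt k))).mul ((hη k).cos.const_mul (g.susc k))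
  have h3 : HasDerivAt (fun t => ∑ k, g.flow ηb Vb k * (η t k - ηb k))
      (∑ k, g.flow ηb Vb k * η' k) t :=
    HasDerivAt.fun_sum fun k _ => ((hη k).sub_const _).const_mul _
  have h4 : HasDerivAt (fun t => ∑ i, g.current ηb Vb i * (V t i - Vb i))
      (∑ i, g.current ηb Vb i * V' i) t :=
    HasDerivAt.fun_sum fun k _ => ((hV k).sub_const _).const_mul _
  unfold divergence energy
  refine ((((h1.sub h2).sub_const _).sub h3).sub h4).congr_deriv ?_
  rw [hsum, g.sum_current_mul (η t)]
  simp only [sub_mul, Finset.sum_sub_distrib]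
  rw [← sub_eq_zero]
  ring_nf
  rw [← Finset.sum_neg_distrib, ← Finset.sum_sub_distrib, ← Finset.sum_add_distrib]
  exact Finset.sum_eq_zero fun k _ => by simp only [flow, Pi.mul_apply]; ring

section

variable {η : ℝ → K → ℝ} {V : ℝ → N → ℝ}

omit [Fintype N] in
lemma _root_.BddLip.current (g : Grid N K) (hη : ∀ k, BddLip fun t => η t k)
    (hV : ∀ i, BddLip fun t => V t i) (i : N) : BddLip fun t => g.current (η t) (V t) i := by
  unfold Grid.current
  refine ((BddLip.const _).mul (hV i)).sub
    (.sum fun k _ => .mul ?_ ((BddLip.const _).mul (.cos (hη k).2)))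
  unfold Grid.opposite
  split_ifs <;> first | exact (hV _).add (hV _) | exact (hV _).add (.const 0) |
    exact (BddLip.const 0).add (hV _) | exact (BddLip.const 0).add (.const 0)

omit [Fintype N] [Fintype K] [DecidableEq N] in
lemma _root_.BddLip.flow (g : Grid N K) (hη : ∀ k, BddLip fun t => η t k)
    (hV : ∀ i, BddLip fun t => V t i) (k : K) : BddLip fun t => g.flow (η t) (V t) k :=
  (((hV _).mul (hV _)).mul (.const _)).mul (.sin (hη k).2)

omit [Fintype N] in
lemma _root_.BddNonneg.current (g : Grid N K) (hV : ∀ i, BddNonneg fun t => V t i) (i : N) :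
    BddNonneg fun t => g.current (η t) (V t) i := by
  unfold Grid.current
  refine ((BddNonneg.const _).mul (hV i)).sub
    (.sum fun k _ => .mul ?_ ((BddNonneg.const _).mul (.cos _)))
  unfold Grid.opposite
  split_ifs <;> first | exact (hV _).add (hV _) | exact (hV _).add (.const 0) |
    exact (BddNonneg.const 0).add (hV _) | exact (BddNonneg.const 0).add (.const 0)

end

end Grid

/-! ### The closed loop in error coordinates -/

/-- A power network with reference voltages, generator dynamics, and at every node a controller
made of a consensus integrator and a copy of an oscillatory exosystem. -/
structure Loop (N K : Type*) (κ : N → Type*) [∀ i, Fintype (κ i)] [∀ i, DecidableEq (κ i)]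
    extends Grid N K where
  /-- inertia -/
  inertia : N → ℝ
  /-- damping -/
  damping : N → ℝ
  /-- time constants of the voltage dynamics -/
  timeConst : N → ℝ
  /-- gains of the consensus integrators -/
  gain : N → ℝ
  /-- communication weights -/
  weight : N → N → ℝ
  /-- exosystem matrices -/
  exo : (i : N) → Matrix (κ i) (κ i) ℝ
  /-- exosystem outputs -/
  out : (i : N) → κ i → ℝ
  /-- reference angles -/
  ηb : K → ℝ
  /-- reference voltages -/
  Vb : N → ℝ
  src_ne_tgt : ∀ k, src k ≠ tgt k
  inertia_pos : ∀ i, 0 < inertia i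
  damping_pos : ∀ i, 0 < damping i
  timeConst_pos : ∀ i, 0 < timeConst i
  gain_pos : ∀ i, 0 < gain i
  weight_nonneg : ∀ i j, 0 ≤ weight i j
  weight_symm : ∀ i j, weight i j = weight j i
  weight_connected : ∀ i j, Relation.ReflTransGen (fun i j => 0 < weight i j) i j
  exo_skew : ∀ i z, z ⬝ᵥ exo i *ᵥ z = 0
  exo_injective : ∀ i z, exo i *ᵥ z = 0 → z = 0
  observable : ∀ i z, (∀ j < Fintype.card (κ i), out i ⬝ᵥ (exo i ^ j) *ᵥ z = 0) → z = 0

namespace Loop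

variable {N K : Type*} [Fintype N] [Fintype K] [DecidableEq N] {κ : N → Type*}
  [∀ i, Fintype (κ i)] [∀ i, DecidableEq (κ i)] (L : Loop N K κ)

/-- The output of the controllers. -/
def control (x : N → ℝ) (z : (i : N) → κ i → ℝ) (i : N) : ℝ :=
  L.gain i * x i + L.out i ⬝ᵥ z i

/-- The deviation of the power injected at the nodes from its reference value. -/
def imbalance (η : K → ℝ) (V : N → ℝ) (i : N) : ℝ :=
  ∑ k, L.inc i k * (L.flow η V k - L.flow L.ηb L.Vb k)

/-- The deviation driving the voltages. -/
def voltageError (η : K → ℝ) (V : N → ℝ) (i : N) : ℝ :=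
  L.current L.ηb L.Vb i - L.current η V i

/-- The storage function of the closed loop. -/
def storage (η : K → ℝ) (V ω x : N → ℝ) (z : (i : N) → κ i → ℝ) : ℝ :=
  1 / 2 * ∑ i, L.inertia i * ω i ^ 2 + L.divergence L.ηb L.Vb η V + 1 / 2 * ∑ i, x i ^ 2
    + 1 / 2 * ∑ i, ∑ j, z i j ^ 2

/-- The dissipation of the storage function along trajectories. -/
def dissipation (η : K → ℝ) (V ω x : N → ℝ) : ℝ :=
  ∑ i, L.damping i * ω i ^ 2 + 1 / 2 * ∑ i, ∑ j, L.weight i j * (x i - x j) ^ 2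
    + ∑ i, (L.timeConst i)⁻¹ * L.voltageError η V i ^ 2

/-- Trajectories of the closed loop in error coordinates. -/
structure IsTrajectory (η : ℝ → K → ℝ) (V ω x : ℝ → N → ℝ) (z : ℝ → (i : N) → κ i → ℝ) :
    Prop where
  angle : ∀ t k, HasDerivAt (fun t => η t k) (ω t (L.src k) - ω t (L.tgt k)) t
  voltage : ∀ t i, HasDerivAt (fun t => V t i)
    ((L.timeConst i)⁻¹ * L.voltageError (η t) (V t) i) t
  frequency : ∀ t i, HasDerivAt (fun t => ω t i) ((L.inertia i)⁻¹ *
    (L.control (x t) (z t) i - L.imbalance (η t) (V t) i - L.damping i * ω t i)) t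
  integrator : ∀ t i, HasDerivAt (fun t => x t i)
    (∑ j, L.weight i j * (x t j - x t i) - L.gain i * ω t i) t
  oscillator : ∀ t i j, HasDerivAt (fun t => z t i j)
    ((L.exo i *ᵥ z t i) j - L.out i j * ω t i) t

variable {L} {η : ℝ → K → ℝ} {V ω x : ℝ → N → ℝ} {z : ℝ → (i : N) → κ i → ℝ}

omit [Fintype K] [DecidableEq N] in
lemma sum_mul_laplacian (y : N → ℝ) :
    ∑ i, y i * ∑ j, L.weight i j * (y j - y i)
      = -(1 / 2 * ∑ i, ∑ j, L.weight i j * (y i - y j) ^ 2) := by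
  have h : ∑ i, ∑ j, L.weight i j * (y i * (y j - y i))
      = ∑ i, ∑ j, L.weight i j * (y j * (y i - y j)) := by
    rw [Finset.sum_comm]
    exact Finset.sum_congr rfl fun i _ => Finset.sum_congr rfl fun j _ => by
      rw [L.weight_symm]
  have h2 : ∑ i, y i * ∑ j, L.weight i j * (y j - y i)
      = ∑ i, ∑ j, L.weight i j * (y i * (y j - y i)) := by
    simp_rw [Finset.mul_sum]
    exact Finset.sum_congr rfl fun i _ => Finset.sum_congr rfl fun j _ => by ring
  have h3 : ∑ i, ∑ j, L.weight i j * (y i - y j) ^ 2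
      = -∑ i, ∑ j, L.weight i j * (y i * (y j - y i))
        - ∑ i, ∑ j, L.weight i j * (y j * (y i - y j)) := by
    simp only [← Finset.sum_neg_distrib, ← Finset.sum_sub_distrib]
    exact Finset.sum_congr rfl fun i _ => Finset.sum_congr rfl fun j _ => by ring
  rw [h3, ← h, h2]
  ring

lemma dissipation_nonneg (η : K → ℝ) (V ω x : N → ℝ) : 0 ≤ L.dissipation η V ω x := by
  have h1 : 0 ≤ ∑ i, L.damping i * ω i ^ 2 :=
    Finset.sum_nonneg fun i _ => mul_nonneg (L.damping_pos i).le (sq_nonneg _)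
  have h2 : 0 ≤ ∑ i, ∑ j, L.weight i j * (x i - x j) ^ 2 :=
    Finset.sum_nonneg fun i _ => Finset.sum_nonneg fun j _ =>
      mul_nonneg (L.weight_nonneg i j) (sq_nonneg _)
  have h3 : 0 ≤ ∑ i, (L.timeConst i)⁻¹ * L.voltageError η V i ^ 2 :=
    Finset.sum_nonneg fun i _ => mul_nonneg (inv_nonneg.2 (L.timeConst_pos i).le) (sq_nonneg _)
  unfold dissipation
  linarith

lemma dominated_by_dissipation (η : K → ℝ) (V ω x : N → ℝ) (i j : N) :
    L.damping i * ω i ^ 2 ≤ L.dissipation η V ω x ∧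
    L.weight i j * (x i - x j) ^ 2 ≤ 2 * L.dissipation η V ω x ∧
    (L.timeConst i)⁻¹ * L.voltageError η V i ^ 2 ≤ L.dissipation η V ω x := by
  have p1 : ∀ i, 0 ≤ L.damping i * ω i ^ 2 := fun i =>
    mul_nonneg (L.damping_pos i).le (sq_nonneg _)
  have p2 : ∀ i j, 0 ≤ L.weight i j * (x i - x j) ^ 2 := fun i j =>
    mul_nonneg (L.weight_nonneg i j) (sq_nonneg _)
  have p3 : ∀ i, 0 ≤ (L.timeConst i)⁻¹ * L.voltageError η V i ^ 2 := fun i =>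
    mul_nonneg (inv_nonneg.2 (L.timeConst_pos i).le) (sq_nonneg _)
  have h1 := Finset.single_le_sum (fun i _ => p1 i) (Finset.mem_univ i)
  have h2 := Finset.single_le_sum (fun j _ => p2 i j) (Finset.mem_univ j)
  have h2' := Finset.single_le_sum (f := fun i => ∑ j, L.weight i j * (x i - x j) ^ 2)
    (fun i _ => Finset.sum_nonneg fun j _ => p2 i j) (Finset.mem_univ i)
  have h3 := Finset.single_le_sum (fun i _ => p3 i) (Finset.mem_univ i)
  have q1 := Finset.sum_nonneg fun i (_ : i ∈ Finset.univ) => p1 i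
  have q2 := Finset.sum_nonneg fun i (_ : i ∈ Finset.univ) => Finset.sum_nonneg
    fun j (_ : j ∈ Finset.univ) => p2 i j
  have q3 := Finset.sum_nonneg fun i (_ : i ∈ Finset.univ) => p3 i
  unfold dissipation
  refine ⟨?_, ?_, ?_⟩ <;> linarith

lemma continuous_storage :
    Continuous fun s : (K → ℝ) × (N → ℝ) × (N → ℝ) × (N → ℝ) × ((i : N) → κ i → ℝ) =>
      L.storage s.1 s.2.1 s.2.2.1 s.2.2.2.1 s.2.2.2.2 := by
  unfold storage Grid.divergence Grid.energy
  fun_prop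

omit [Fintype N] [Fintype K] [DecidableEq N] in
lemma dotProduct_oscillator (i : N) (y : κ i → ℝ) (r : ℝ) :
    ∑ j, y j * ((L.exo i *ᵥ y) j - L.out i j * r) = -(L.out i ⬝ᵥ y * r) := by
  have h := L.exo_skew i y
  simp only [dotProduct] at h ⊢
  simp only [mul_sub, Finset.sum_sub_distrib, h, Finset.sum_mul, zero_sub, neg_inj]
  exact Finset.sum_congr rfl fun j _ => by ring

namespace IsTrajectory

lemma hasDerivAt_storage (h : L.IsTrajectory η V ω x z) (t : ℝ) :
    HasDerivAt (fun t => L.storage (η t) (V t) (ω t) (x t) (z t))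
      (-L.dissipation (η t) (V t) (ω t) (x t)) t := by
  have h1 : HasDerivAt (fun t => 1 / 2 * ∑ i, L.inertia i * ω t i ^ 2) (∑ i, ω t i *
      (L.control (x t) (z t) i - L.imbalance (η t) (V t) i - L.damping i * ω t i)) t := by
    refine ((HasDerivAt.fun_sum fun i (_ : i ∈ Finset.univ) =>
      ((h.frequency t i).fun_pow 2).const_mul (L.inertia i)).const_mul (1 / 2)).congr_deriv ?_
    rw [Finset.mul_sum]
    refine Finset.sum_congr rfl fun i _ => ?_
    have := (L.inertia_pos i).ne'
    push_cast
    field_simp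
  have h2 := L.hasDerivAt_divergence L.ηb L.Vb (h.angle t) (h.voltage t)
  have h3 : HasDerivAt (fun t => 1 / 2 * ∑ i, x t i ^ 2)
      (∑ i, x t i * (∑ j, L.weight i j * (x t j - x t i) - L.gain i * ω t i)) t := by
    refine ((HasDerivAt.fun_sum fun i (_ : i ∈ Finset.univ) =>
      ((h.integrator t i).fun_pow 2)).const_mul (1 / 2)).congr_deriv ?_
    rw [Finset.mul_sum]
    exact Finset.sum_congr rfl fun i _ => by push_cast; ring
  have h4 : HasDerivAt (fun t => 1 / 2 * ∑ i, ∑ j, z t i j ^ 2)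
      (∑ i, ∑ j, z t i j * ((L.exo i *ᵥ z t i) j - L.out i j * ω t i)) t := by
    refine ((HasDerivAt.fun_sum fun i (_ : i ∈ Finset.univ) => HasDerivAt.fun_sum
      fun j (_ : j ∈ Finset.univ) =>
        ((h.oscillator t i j).fun_pow 2)).const_mul (1 / 2)).congr_deriv ?_
    simp only [Finset.mul_sum]
    exact Finset.sum_congr rfl fun i _ => Finset.sum_congr rfl fun j _ => by push_cast; ring
  refine (((h1.add h2).add h3).add h4).congr_deriv ?_
  simp only [dotProduct_oscillator, mul_sub (x t _), Finset.sum_sub_distrib, sum_mul_laplacian]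
  have e1 : ∑ i, ω t i * (L.control (x t) (z t) i - L.imbalance (η t) (V t) i
      - L.damping i * ω t i) = ∑ i, x t i * (L.gain i * ω t i)
        + ∑ i, L.out i ⬝ᵥ z t i * ω t i
        - ∑ i, ω t i * L.imbalance (η t) (V t) i - ∑ i, L.damping i * ω t i ^ 2 := by
    simp only [← Finset.sum_add_distrib, ← Finset.sum_sub_distrib]
    exact Finset.sum_congr rfl fun i _ => by rw [control]; ring
  have e2 : ∑ i, ω t i * L.imbalance (η t) (V t) i = _ :=
    Grid.sum_mul_sum_inc L.src_ne_tgt (ω t) fun k => L.flow (η t) (V t) k - L.flow L.ηb L.Vb k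
  have e3 : ∑ i, (L.current (η t) (V t) i - L.current L.ηb L.Vb i)
      * ((L.timeConst i)⁻¹ * L.voltageError (η t) (V t) i)
      = -∑ i, (L.timeConst i)⁻¹ * L.voltageError (η t) (V t) i ^ 2 := by
    rw [← Finset.sum_neg_distrib]
    exact Finset.sum_congr rfl fun i _ => by rw [voltageError]; ring
  rw [e1, e2, e3, dissipation, Finset.sum_neg_distrib]
  ring

lemma antitone_storage (h : L.IsTrajectory η V ω x z) :
    Antitone fun t => L.storage (η t) (V t) (ω t) (x t) (z t) :=
  antitone_of_hasDerivAt_nonpos h.hasDerivAt_storage fun _ =>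
    neg_nonpos.2 (L.dissipation_nonneg _ _ _ _)

end IsTrajectory

lemma le_storage (η : K → ℝ) (V ω x : N → ℝ) (z : (i : N) → κ i → ℝ) :
    L.divergence L.ηb L.Vb η V ≤ L.storage η V ω x z ∧
    ∀ i, L.divergence L.ηb L.Vb η V + 1 / 2 * (L.inertia i * ω i ^ 2) ≤ L.storage η V ω x z ∧
      L.divergence L.ηb L.Vb η V + 1 / 2 * x i ^ 2 ≤ L.storage η V ω x z ∧
      ∀ j, L.divergence L.ηb L.Vb η V + 1 / 2 * z i j ^ 2 ≤ L.storage η V ω x z := by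
  have p1 : ∀ i, 0 ≤ L.inertia i * ω i ^ 2 := fun i =>
    mul_nonneg (L.inertia_pos i).le (sq_nonneg _)
  have q1 := Finset.sum_nonneg fun i (_ : i ∈ Finset.univ) => p1 i
  have q2 := Finset.sum_nonneg fun i (_ : i ∈ Finset.univ) => sq_nonneg (x i)
  have q3 := Finset.sum_nonneg fun i (_ : i ∈ Finset.univ) => Finset.sum_nonneg
    fun j (_ : j ∈ Finset.univ) => sq_nonneg (z i j)
  unfold storage
  refine ⟨by linarith, fun i => ?_⟩
  have h1 := Finset.single_le_sum (fun i _ => p1 i) (Finset.mem_univ i)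
  have h2 := Finset.single_le_sum (fun i _ => sq_nonneg (x i)) (Finset.mem_univ i)
  have h3 := Finset.single_le_sum (f := fun i => ∑ j, z i j ^ 2)
    (fun i _ => Finset.sum_nonneg fun j _ => sq_nonneg (z i j)) (Finset.mem_univ i)
  refine ⟨by linarith, by linarith, fun j => ?_⟩
  have h4 := Finset.single_le_sum (fun j _ => sq_nonneg (z i j)) (Finset.mem_univ j)
  linarith

end Loop

namespace Loop.IsTrajectory

variable {N K : Type*} [Fintype N] [Fintype K] [DecidableEq N] {κ : N → Type*}
  [∀ i, Fintype (κ i)] [∀ i, DecidableEq (κ i)] {L : Loop N K κ}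
  {η : ℝ → K → ℝ} {V ω x : ℝ → N → ℝ} {z : ℝ → (i : N) → κ i → ℝ}

/-- A trajectory that starts with little stored energy stays close to the reference point. -/
lemma norm_lt_of_storage_lt (h : L.IsTrajectory η V ω x z) {ρ c : ℝ}
    (hlow : ∀ (y : K → ℝ) (v : N → ℝ), ‖(y, v)‖ ≤ ρ →
      c * ‖(y, v)‖ ^ 2 ≤ L.divergence L.ηb L.Vb (L.ηb + y) (L.Vb + v))
    (h0 : ‖(η 0 - L.ηb, V 0 - L.Vb)‖ < ρ)
    (hW : L.storage (η 0) (V 0) (ω 0) (x 0) (z 0) < c * ρ ^ 2) {t : ℝ} (ht : 0 ≤ t) :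
    ‖(η t - L.ηb, V t - L.Vb)‖ < ρ := by
  by_contra! hge
  have hcont : Continuous fun t => ‖(η t - L.ηb, V t - L.Vb)‖ := by
    have h1 : Continuous η := continuous_pi fun k =>
      continuous_iff_continuousAt.2 fun t => (h.angle t k).continuousAt
    have h2 : Continuous V := continuous_pi fun i =>
      continuous_iff_continuousAt.2 fun t => (h.voltage t i).continuousAt
    fun_prop
  obtain ⟨s, hs, hsρ⟩ := intermediate_value_Icc ht hcont.continuousOn ⟨h0.le, hge⟩
  have h1 := hlow _ _ hsρ.le
  simp only [hsρ, add_sub_cancel] at h1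
  have h2 := h.antitone_storage hs.1
  have h3 := (L.le_storage (η s) (V s) (ω s) (x s) (z s)).1
  simp only at h2
  linarith

lemma bddNonneg (h : L.IsTrajectory η V ω x z) {ρ : ℝ}
    (hρ : ∀ t, 0 ≤ t → ‖(η t - L.ηb, V t - L.Vb)‖ < ρ)
    (hdiv : ∀ t, 0 ≤ t → 0 ≤ L.divergence L.ηb L.Vb (η t) (V t)) :
    (∀ k, BddNonneg fun t => η t k) ∧ (∀ i, BddNonneg fun t => V t i) ∧
    (∀ i, BddNonneg fun t => ω t i) ∧ (∀ i, BddNonneg fun t => x t i) ∧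
    ∀ i j, BddNonneg fun t => z t i j := by
  have hW : ∀ t, 0 ≤ t → L.storage (η t) (V t) (ω t) (x t) (z t) ≤
      L.storage (η 0) (V 0) (ω 0) (x 0) (z 0) := fun t ht => h.antitone_storage ht
  have hle := fun t => (L.le_storage (η t) (V t) (ω t) (x t) (z t)).2
  refine ⟨fun k => ?_, fun i => ?_, fun i => ?_, fun i => ?_, fun i j => ?_⟩
  · have : BddNonneg fun t => η t k - L.ηb k := ⟨ρ, fun t ht =>
      ((norm_le_pi_norm (η t - L.ηb) k).trans (norm_fst_le (η t - L.ηb, V t - L.Vb))).trans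
        (hρ t ht).le⟩
    simpa using this.add (.const (L.ηb k))
  · have : BddNonneg fun t => V t i - L.Vb i := ⟨ρ, fun t ht =>
      ((norm_le_pi_norm (V t - L.Vb) i).trans (norm_snd_le (η t - L.ηb, V t - L.Vb))).trans
        (hρ t ht).le⟩
    simpa using this.add (.const (L.Vb i))
  · exact bddNonneg_of_sq_le (L.inertia_pos i)
      (C := 2 * L.storage (η 0) (V 0) (ω 0) (x 0) (z 0)) fun t ht => by
        linarith [hW t ht, hdiv t ht, (hle t i).1]
  · exact bddNonneg_of_sq_le (one_half_pos (α := ℝ))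
      (C := L.storage (η 0) (V 0) (ω 0) (x 0) (z 0)) fun t ht => by
        linarith [hW t ht, hdiv t ht, (hle t i).2.1]
  · exact bddNonneg_of_sq_le (one_half_pos (α := ℝ))
      (C := L.storage (η 0) (V 0) (ω 0) (x 0) (z 0)) fun t ht => by
        linarith [hW t ht, hdiv t ht, (hle t i).2.2 j]

lemma bddLip (h : L.IsTrajectory η V ω x z) (hη : ∀ k, BddNonneg fun t => η t k)
    (hV : ∀ i, BddNonneg fun t => V t i) (hω : ∀ i, BddNonneg fun t => ω t i)
    (hx : ∀ i, BddNonneg fun t => x t i) (hz : ∀ i j, BddNonneg fun t => z t i j) :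
    (∀ k, BddLip fun t => η t k) ∧ (∀ i, BddLip fun t => V t i) ∧
    (∀ i, BddLip fun t => ω t i) ∧ (∀ i, BddLip fun t => x t i) ∧
    ∀ i j, BddLip fun t => z t i j := by
  have hflow : ∀ k, BddNonneg fun t => L.flow (η t) (V t) k := fun k =>
    (((hV _).mul (hV _)).mul (.const _)).mul (.sin _)
  refine ⟨fun k => ?_, fun i => ?_, fun i => ?_, fun i => ?_, fun i j => ?_⟩
  · exact .of_deriv (hη k) (fun t => h.angle t k) ((hω _).sub (hω _))
  · exact .of_deriv (hV i) (fun t => h.voltage t i)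
      ((BddNonneg.const _).mul ((BddNonneg.const _).sub (.current _ hV i)))
  · refine .of_deriv (hω i) (fun t => h.frequency t i) ((BddNonneg.const _).mul
      ((BddNonneg.sub ?_ ?_).sub ((BddNonneg.const _).mul (hω i))))
    · exact ((BddNonneg.const _).mul (hx i)).add (.sum fun j _ => (BddNonneg.const _).mul (hz i j))
    · exact .sum fun k _ => (BddNonneg.const _).mul ((hflow k).sub (.const _))
  · exact .of_deriv (hx i) (fun t => h.integrator t i) ((BddNonneg.sum fun j _ =>
      (BddNonneg.const _).mul ((hx j).sub (hx i))).sub ((BddNonneg.const _).mul (hω i)))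
  · exact .of_deriv (hz i j) (fun t => h.oscillator t i j) ((BddNonneg.sum fun j' _ =>
      (BddNonneg.const _).mul (hz i j')).sub ((BddNonneg.const _).mul (hω i)))

/-- The storage function is monotone and its derivative is Lipschitz, so the dissipation
vanishes at infinity. -/
lemma tendsto_dissipation (h : L.IsTrajectory η V ω x z) (hη : ∀ k, BddLip fun t => η t k)
    (hV : ∀ i, BddLip fun t => V t i) (hω : ∀ i, BddLip fun t => ω t i)
    (hx : ∀ i, BddLip fun t => x t i)
    (hdiv : ∀ t, 0 ≤ t → 0 ≤ L.divergence L.ηb L.Vb (η t) (V t)) :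
    Tendsto (fun t => L.dissipation (η t) (V t) (ω t) (x t)) atTop (𝓝 0) := by
  have hpos : ∀ t, 0 ≤ t → 0 ≤ L.storage (η t) (V t) (ω t) (x t) (z t) := fun t ht =>
    (hdiv t ht).trans (L.le_storage _ _ _ _ _).1
  have hlim := tendsto_atTop_ciInf h.antitone_storage ⟨0, by
    rintro _ ⟨t, rfl⟩
    exact (hpos (max 0 t) (le_max_left _ _)).trans (h.antitone_storage (le_max_right _ _))⟩
  have hlip : BddLip fun t => L.dissipation (η t) (V t) (ω t) (x t) := by
    have hsq : ∀ {f : ℝ → ℝ}, BddLip f → BddLip fun t => f t ^ 2 := fun hf => by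
      simpa [sq] using hf.mul hf
    exact ((BddLip.sum fun i _ => (BddLip.const _).mul (hsq (hω i))).add
      ((BddLip.const _).mul (.sum fun i _ => .sum fun j _ =>
        (BddLip.const _).mul (hsq ((hx i).sub (hx j)))))).add
      (.sum fun i _ => (BddLip.const _).mul (hsq ((BddLip.const _).sub (.current _ hη hV i))))
  have := ((BddLip.const 0).sub hlip).2.tendsto_zero (h := fun _ => 0) hlim
    (fun t => by simpa using h.hasDerivAt_storage t) tendsto_const_nhds
  simpa using this.neg

lemma hasDerivAt_dotProduct (h : L.IsTrajectory η V ω x z) (i : N) (d : κ i → ℝ) (t : ℝ) :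
    HasDerivAt (fun t => d ⬝ᵥ z t i) ((d ᵥ* L.exo i) ⬝ᵥ z t i + -(d ⬝ᵥ L.out i) * ω t i) t := by
  refine (HasDerivAt.fun_sum fun j (_ : j ∈ Finset.univ) =>
    (h.oscillator t i j).const_mul (d j)).congr_deriv ?_
  rw [← dotProduct_mulVec]
  simp only [dotProduct, neg_mul, Finset.sum_mul, ← sub_eq_add_neg, ← Finset.sum_sub_distrib]
  exact Finset.sum_congr rfl fun j _ => by ring

lemma tendsto_oscillator (h : L.IsTrajectory η V ω x z)
    (hz : ∀ i j, BddLip fun t => z t i j) (hω : ∀ i, Tendsto (fun t => ω t i) atTop (𝓝 0))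
    (i : N) (h1 : Tendsto (fun t => (L.out i ᵥ* L.exo i) ⬝ᵥ z t i) atTop (𝓝 0)) :
    Tendsto (fun t => z t i) atTop (𝓝 0) := by
  have hall : ∀ j : ℕ,
      Tendsto (fun t => (L.out i ᵥ* L.exo i ^ (j + 1)) ⬝ᵥ z t i) atTop (𝓝 0) := by
    intro j
    induction j with
    | zero => simpa using h1
    | succ j ih =>
      have hlip : BddLip fun t => (L.out i ᵥ* L.exo i ^ (j + 1 + 1)) ⬝ᵥ z t i :=
        .sum fun k _ => (BddLip.const _).mul (hz i k)
      refine hlip.2.tendsto_zero ih (fun t => ?_)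
        (h := fun t => -((L.out i ᵥ* L.exo i ^ (j + 1)) ⬝ᵥ L.out i) * ω t i)
        (by simpa using (hω i).const_mul (-((L.out i ᵥ* L.exo i ^ (j + 1)) ⬝ᵥ L.out i)))
      have := h.hasDerivAt_dotProduct i (L.out i ᵥ* L.exo i ^ (j + 1)) t
      rwa [vecMul_vecMul, ← pow_succ] at this
  let A : (κ i → ℝ) →ₗ[ℝ] (Fin (Fintype.card (κ i)) → ℝ) :=
    Matrix.mulVecLin (Matrix.of fun j => L.out i ᵥ* L.exo i ^ ((j : ℕ) + 1))
  have hA : ∀ y j, A y j = (L.out i ᵥ* L.exo i ^ ((j : ℕ) + 1)) ⬝ᵥ y := fun y j => rfl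
  have hker : LinearMap.ker A = ⊥ := by
    rw [LinearMap.ker_eq_bot']
    intro y hy
    refine L.exo_injective i y (L.observable i _ fun j hj => ?_)
    have := congrFun hy ⟨j, hj⟩
    rwa [hA, ← dotProduct_mulVec, pow_succ, ← mulVec_mulVec] at this
  obtain ⟨B, hB⟩ := A.exists_leftInverse_of_injective hker
  have h2 : Tendsto (fun t => A (z t i)) atTop (𝓝 0) := tendsto_pi_nhds.2 fun j => hall j
  have h3 := (LinearMap.continuous_of_finiteDimensional B).tendsto 0 |>.comp h2
  rw [map_zero] at h3
  refine h3.congr fun t => ?_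
  exact LinearMap.congr_fun hB (z t i)

lemma tendsto_of_bddLip (h : L.IsTrajectory η V ω x z) (hη : ∀ k, BddLip fun t => η t k)
    (hV : ∀ i, BddLip fun t => V t i) (hω : ∀ i, BddLip fun t => ω t i)
    (hx : ∀ i, BddLip fun t => x t i) (hz : ∀ i j, BddLip fun t => z t i j)
    (hdiv : ∀ t, 0 ≤ t → 0 ≤ L.divergence L.ηb L.Vb (η t) (V t)) (i : N) :
    Tendsto (fun t => ω t i) atTop (𝓝 0) ∧
    Tendsto (fun t => L.control (x t) (z t) i) atTop (𝓝 0) := by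
  have hd := h.tendsto_dissipation hη hV hω hx hdiv
  have hω0 : ∀ i, Tendsto (fun t => ω t i) atTop (𝓝 0) := fun i =>
    tendsto_zero_of_sq_le (L.damping_pos i) hd fun t =>
      (L.dominated_by_dissipation _ _ _ _ i i).1
  have hv0 : ∀ i, Tendsto (fun t => (L.timeConst i)⁻¹ * L.voltageError (η t) (V t) i)
      atTop (𝓝 0) := fun i => by
    simpa using (tendsto_zero_of_sq_le (inv_pos.2 (L.timeConst_pos i)) hd fun t =>
      (L.dominated_by_dissipation _ _ _ _ i i).2.2).const_mul (L.timeConst i)⁻¹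
  have hd2 : Tendsto (fun t => 2 * L.dissipation (η t) (V t) (ω t) (x t)) atTop (𝓝 0) := by
    simpa using hd.const_mul 2
  have hx0 : ∀ i j, Tendsto (fun t => x t i - x t j) atTop (𝓝 0) := by
    intro i j
    induction L.weight_connected i j with
    | refl => simp
    | @tail b c _ hbc ih =>
      simpa using ih.add (tendsto_zero_of_sq_le hbc hd2 fun t =>
        (L.dominated_by_dissipation _ _ (ω t) (x t) b c).2.1)
  have himb : ∀ i, BddLip fun t => L.imbalance (η t) (V t) i := fun i =>
    .sum fun k _ => (BddLip.const _).mul ((BddLip.flow _ hη hV k).sub (.const _))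
  have hctl : ∀ i, BddLip fun t => L.control (x t) (z t) i := fun i =>
    ((BddLip.const _).mul (hx i)).add (.sum fun j _ => (BddLip.const _).mul (hz i j))
  have hbal : ∀ i, Tendsto (fun t => L.control (x t) (z t) i - L.imbalance (η t) (V t) i)
      atTop (𝓝 0) := by
    intro i
    have h1 := ((BddLip.const (L.inertia i)⁻¹).mul ((hctl i).sub (himb i))).2.tendsto_zero
      (hω0 i) (h := fun t => -((L.inertia i)⁻¹ * L.damping i) * ω t i)
      (fun t => (h.frequency t i).congr_deriv (by ring))
      (by simpa using (hω0 i).const_mul (-((L.inertia i)⁻¹ * L.damping i)))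
    have h2 := h1.const_mul (L.inertia i)
    rw [mul_zero] at h2
    exact h2.congr fun t => by rw [mul_inv_cancel_left₀ (L.inertia_pos i).ne']
  have hz0 : ∀ i, Tendsto (fun t => z t i) atTop (𝓝 0) := by
    intro i
    refine h.tendsto_oscillator hz hω0 i ?_
    have hlip : BddLip fun t => (L.out i ᵥ* L.exo i) ⬝ᵥ z t i :=
      .sum fun k _ => (BddLip.const _).mul (hz i k)
    have hflow : ∀ t k, HasDerivAt (fun t => L.flow (η t) (V t) k)
        (V t (L.tgt k) * L.susc k * sin (η t k) *
            ((L.timeConst (L.src k))⁻¹ * L.voltageError (η t) (V t) (L.src k))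
          + V t (L.src k) * L.susc k * sin (η t k) *
            ((L.timeConst (L.tgt k))⁻¹ * L.voltageError (η t) (V t) (L.tgt k))
          + V t (L.src k) * V t (L.tgt k) * L.susc k * cos (η t k) *
            (ω t (L.src k) - ω t (L.tgt k))) t := fun t k => by
      refine ((((h.voltage t (L.src k)).fun_mul (h.voltage t (L.tgt k))).mul_const
        (L.susc k)).fun_mul (h.angle t k).sin).congr_deriv ?_
      ring
    refine hlip.2.tendsto_zero (hbal i) (fun t => ((((h.integrator t i).const_mul _).fun_add
      (h.hasDerivAt_dotProduct i _ t)).fun_sub (HasDerivAt.fun_sum fun k (_ : k ∈ Finset.univ) =>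
        ((hflow t k).sub_const _).const_mul _)).congr_deriv ?_)
      (h := fun t => (L.gain i * (∑ j, L.weight i j * (x t j - x t i) - L.gain i * ω t i)
        + -(L.out i ⬝ᵥ L.out i) * ω t i) - ∑ k, L.inc i k *
        (V t (L.tgt k) * L.susc k * sin (η t k) *
            ((L.timeConst (L.src k))⁻¹ * L.voltageError (η t) (V t) (L.src k))
          + V t (L.src k) * L.susc k * sin (η t k) *
            ((L.timeConst (L.tgt k))⁻¹ * L.voltageError (η t) (V t) (L.tgt k))
          + V t (L.src k) * V t (L.tgt k) * L.susc k * cos (η t k) *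
            (ω t (L.src k) - ω t (L.tgt k)))) ?_
    · ring
    · have t1 : Tendsto (fun t => ∑ j, L.weight i j * (x t j - x t i)) atTop (𝓝 0) := by
        simpa using tendsto_finsetSum Finset.univ fun j _ =>
          (hx0 j i).const_mul (L.weight i j)
      have t2 : ∀ k, Tendsto (fun t => ω t (L.src k) - ω t (L.tgt k)) atTop (𝓝 0) := fun k => by
        simpa using (hω0 (L.src k)).sub (hω0 (L.tgt k))
      have b1 : ∀ k i, BddNonneg fun t => V t i * L.susc k * sin (η t k) := fun k i =>
        ((hV i).1.mul (.const _)).mul (.sin _)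
      have b2 : ∀ k, BddNonneg fun t => V t (L.src k) * V t (L.tgt k) * L.susc k *
          cos (η t k) := fun k => (((hV _).1.mul (hV _).1).mul (.const _)).mul (.cos _)
      have t3 := tendsto_finsetSum Finset.univ fun k _ =>
        ((((b1 k (L.tgt k)).tendsto_mul_zero (hv0 (L.src k))).add
          ((b1 k (L.src k)).tendsto_mul_zero (hv0 (L.tgt k)))).add
          ((b2 k).tendsto_mul_zero (t2 k))).const_mul (L.inc i k)
      simpa using (((t1.sub ((hω0 i).const_mul (L.gain i))).const_mul (L.gain i)).add
        ((hω0 i).const_mul (-(L.out i ⬝ᵥ L.out i)))).sub t3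
  have hout : ∀ i, Tendsto (fun t => L.out i ⬝ᵥ z t i) atTop (𝓝 0) := fun i => by
    simpa [dotProduct] using tendsto_finsetSum Finset.univ fun j _ =>
      (tendsto_pi_nhds.1 (hz0 i) j).const_mul (L.out i j)
  refine ⟨hω0 i, ?_⟩
  have hgain : 0 < ∑ j, L.gain j :=
    Finset.sum_pos (fun j _ => L.gain_pos j) ⟨i, Finset.mem_univ i⟩
  have hxi : Tendsto (fun t => x t i) atTop (𝓝 0) := by
    have hsum := ((tendsto_finsetSum Finset.univ fun j _ => hbal j).sub
      (tendsto_finsetSum Finset.univ fun j _ => hout j)).sub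
      (tendsto_finsetSum Finset.univ fun j _ => (hx0 j i).const_mul (L.gain j))
    have h2 := hsum.const_mul (∑ j, L.gain j)⁻¹
    simp only [Finset.sum_const_zero, sub_zero, mul_zero] at h2
    refine h2.congr fun t => ?_
    have himb0 : ∑ j, L.imbalance (η t) (V t) j = 0 := by
      simpa [imbalance] using Grid.sum_mul_sum_inc L.src_ne_tgt (fun _ => 1)
        fun k => L.flow (η t) (V t) k - L.flow L.ηb L.Vb k
    rw [Finset.sum_sub_distrib, himb0, inv_mul_eq_iff_eq_mul₀ hgain.ne', Finset.sum_mul, sub_zero,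
      ← Finset.sum_sub_distrib, ← Finset.sum_sub_distrib]
    exact Finset.sum_congr rfl fun j _ => by rw [control]; ring
  simpa [control] using (hxi.const_mul (L.gain i)).add (hout i)

end Loop.IsTrajectory

/-- Local convergence of the closed loop in error coordinates. -/
lemma Loop.exists_pos_forall_tendsto {N K : Type*} [Fintype N] [Fintype K] [DecidableEq N]
    {κ : N → Type*} [∀ i, Fintype (κ i)] [∀ i, DecidableEq (κ i)] (L : Loop N K κ)
    (hB : ∀ k, 0 < L.susc k) (hVb : ∀ i, 0 < L.Vb i) (hcos : ∀ k, 0 < cos (L.ηb k))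
    (hschur : ∀ v, v ≠ 0 → 0 < L.schurForm L.ηb L.Vb v) :
    ∃ ε > 0, ∀ (η : ℝ → K → ℝ) (V ω x : ℝ → N → ℝ) (z : ℝ → (i : N) → κ i → ℝ),
      L.IsTrajectory η V ω x z → dist (η 0) L.ηb < ε → dist (V 0) L.Vb < ε → dist (ω 0) 0 < ε →
      dist (x 0) 0 < ε → dist (z 0) 0 < ε → ∀ i, Tendsto (fun t => ω t i) atTop (𝓝 0) ∧
        Tendsto (fun t => L.control (x t) (z t) i) atTop (𝓝 0) := by
  obtain ⟨ρ, hρ, c, hc, hlow⟩ := Grid.exists_le_divergence hB hVb hcos hschur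
  have h0 : L.storage L.ηb L.Vb 0 0 0 = 0 := by simp [storage, Grid.divergence_self]
  obtain ⟨ε, hε, hW⟩ := Metric.continuousAt_iff.1
    (L.continuous_storage.continuousAt (x := (L.ηb, L.Vb, 0, 0, 0))) (c * ρ ^ 2) (by positivity)
  refine ⟨min ε ρ, lt_min hε hρ, fun η V ω x z h h1 h2 h3 h4 h5 => ?_⟩
  have hW0 := @hW (η 0, V 0, ω 0, x 0, z 0) (by
    simp only [Prod.dist_eq, max_lt_iff]
    exact ⟨h1.trans_le (min_le_left _ _), h2.trans_le (min_le_left _ _),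
      h3.trans_le (min_le_left _ _), h4.trans_le (min_le_left _ _),
      h5.trans_le (min_le_left _ _)⟩)
  simp only [h0, Real.dist_eq, sub_zero] at hW0
  have hball : ∀ t, 0 ≤ t → ‖(η t - L.ηb, V t - L.Vb)‖ < ρ := fun t ht =>
    h.norm_lt_of_storage_lt hlow (by
      rw [Prod.norm_def, ← dist_eq_norm, ← dist_eq_norm]
      exact max_lt (h1.trans_le (min_le_right _ _)) (h2.trans_le (min_le_right _ _)))
      ((le_abs_self _).trans_lt hW0) ht
  have hdiv : ∀ t, 0 ≤ t → 0 ≤ L.divergence L.ηb L.Vb (η t) (V t) := fun t ht => by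
    have := hlow _ _ (hball t ht).le
    simp only [add_sub_cancel] at this
    exact le_trans (by positivity) this
  obtain ⟨b1, b2, b3, b4, b5⟩ := h.bddNonneg hball hdiv
  obtain ⟨l1, l2, l3, l4, l5⟩ := h.bddLip b1 b2 b3 b4 b5
  exact h.tendsto_of_bddLip l1 l2 l3 l4 l5 hdiv

/-! ### The power network of the theorem -/

section

variable {n m r : ℕ} {ep1 ep2 : Fin m → Fin n}

/-- The grid with given incidence, susceptances and machine reactances. -/
def gridOf (ep1 ep2 : Fin m → Fin n) (B : Fin m → ℝ) (Bii Xd Xd' : Vec n) :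
    Grid (Fin n) (Fin m) where
  src := ep1
  tgt := ep2
  susc := B
  self i := (1 - Bii i * (Xd i - Xd' i)) / (Xd i - Xd' i)

lemma Emat_mulVec (hep : ∀ k, ep1 k ≠ ep2 k) (B : Fin m → ℝ) (Bii Xd Xd' : Vec n) (η : Vec m)
    (v : Vec n) :
    Emat ep1 ep2 B Bii Xd Xd' η *ᵥ v = (gridOf ep1 ep2 B Bii Xd Xd').current η v := by
  ext i
  have hentry : ∀ j, Emat ep1 ep2 B Bii Xd Xd' η i j * v j
      = (if i = j then (1 - Bii i * (Xd i - Xd' i)) / (Xd i - Xd' i) * v j else 0)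
        - ∑ k, (if (ep1 k = i ∧ ep2 k = j) ∨ (ep1 k = j ∧ ep2 k = i)
          then B k * cos (η k) else 0) * v j := by
    intro j
    rw [Emat, of_apply, ← Finset.sum_mul]
    split_ifs with hij
    · subst hij
      have h0 : ∀ k, ¬(ep1 k = i ∧ ep2 k = i) := fun k h => hep k (h.1.trans h.2.symm)
      simp [h0]
    · ring
  simp only [mulVec, dotProduct, hentry, Finset.sum_sub_distrib]
  rw [Finset.sum_ite_eq, if_pos (Finset.mem_univ i), Finset.sum_comm, Grid.current]
  congr 1
  refine Finset.sum_congr rfl fun k _ => ?_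
  have hk := hep k
  simp only [Grid.opposite, gridOf]
  by_cases h1 : ep1 k = i
  · have h2 : ep2 k ≠ i := fun h2 => hk (h1.trans h2.symm)
    simp [h1, h2, h2.symm, mul_comm]
  · by_cases h2 : ep2 k = i
    · simp [h1, Ne.symm h1, h2, mul_comm]
    · simp [h1, h2, Ne.symm h1, Ne.symm h2]

lemma incD_mulVec_flow (B : Fin m → ℝ) (Bii Xd Xd' : Vec n) (η : Vec m) (V : Vec n) (i : Fin n) :
    (incD ep1 ep2 *ᵥ (Gam ep1 ep2 B V *ᵥ sinv η)) i
      = ∑ k, (gridOf ep1 ep2 B Bii Xd Xd').inc i k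
        * (gridOf ep1 ep2 B Bii Xd Xd').flow η V k := by
  change ∑ k, incD ep1 ep2 i k * (Gam ep1 ep2 B V *ᵥ sinv η) k = _
  refine Finset.sum_congr rfl fun k _ => ?_
  rw [Gam, mulVec_diagonal]
  rfl

lemma absD_transpose_mulVec (hep : ∀ k, ep1 k ≠ ep2 k) (v : Vec n) (k : Fin m) :
    ((absD ep1 ep2)ᵀ *ᵥ v) k = v (ep1 k) + v (ep2 k) := by
  have h : ∀ i, (absD ep1 ep2)ᵀ k i * v i
      = (if i = ep1 k then v i else 0) + (if i = ep2 k then v i else 0) := by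
    intro i
    simp only [transpose_apply, absD, incD, of_apply]
    split_ifs with h1 h2 <;> first | exact absurd (h1.symm.trans h2) (hep k) | simp
  simp only [mulVec, dotProduct, h]
  simp [Finset.sum_add_distrib]

lemma incD_transpose_mulVec (hep : ∀ k, ep1 k ≠ ep2 k) (v : Vec n) (k : Fin m) :
    ((incD ep1 ep2)ᵀ *ᵥ v) k = v (ep1 k) - v (ep2 k) :=
  Grid.sum_inc_mul (g := gridOf ep1 ep2 0 0 0 0) hep v k

lemma dotProduct_Schur_mulVec (hep : ∀ k, ep1 k ≠ ep2 k) (B : Fin m → ℝ) (Bii Xd Xd' : Vec n)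
    {ηb : Vec m} (hcos : ∀ k, 0 < cos (ηb k)) (Vb v : Vec n) :
    v ⬝ᵥ Schur ep1 ep2 B Bii Xd Xd' ηb Vb *ᵥ v
      = (gridOf ep1 ep2 B Bii Xd Xd').schurForm ηb Vb v := by
  have hinv : (diagonal (cosv ηb))⁻¹ = diagonal fun k => (cos (ηb k))⁻¹ := by
    refine inv_eq_right_inv ?_
    rw [diagonal_mul_diagonal, ← diagonal_one]
    congr 1
    ext k
    exact mul_inv_cancel₀ (hcos k).ne'
  have hy : ∀ k, ((absD ep1 ep2)ᵀ *ᵥ ((diagonal fun i => (Vb i)⁻¹) *ᵥ v)) k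
      = v (ep1 k) / Vb (ep1 k) + v (ep2 k) / Vb (ep2 k) := by
    intro k
    rw [absD_transpose_mulVec hep]
    simp only [mulVec_diagonal]
    ring
  have hquad : ∀ w : Vec m, v ⬝ᵥ (diagonal fun i => (Vb i)⁻¹) *ᵥ (absD ep1 ep2 *ᵥ w)
      = ∑ k, (v (ep1 k) / Vb (ep1 k) + v (ep2 k) / Vb (ep2 k)) * w k := by
    intro w
    rw [dotProduct_mulVec, dotProduct_mulVec, ← mulVec_transpose, ← mulVec_transpose,
      diagonal_transpose]
    simp only [dotProduct, hy]
  rw [Schur, hinv, sub_mulVec, dotProduct_sub, Emat_mulVec hep, dotProduct_comm]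
  simp only [← mulVec_mulVec]
  rw [hquad]
  change ∑ i, _ * _ - _ = _
  rw [Grid.sum_current_mul, Grid.schurForm, sub_sub, ← Finset.sum_add_distrib]
  congr 1
  · exact Finset.sum_congr rfl fun i _ => by ring
  · refine Finset.sum_congr rfl fun k _ => ?_
    simp only [Gam, mulVec_diagonal, hy, sinv, gridOf]
    ring

/-- The closed loop of the theorem. -/
def loopOf (hep : ∀ k, ep1 k ≠ ep2 k) (B : Fin m → ℝ) (Bii Xd Xd' : Vec n)
    {Md Ad Td : Vec n} (hM : ∀ i, 0 < Md i) (hA : ∀ i, 0 < Ad i) (hT : ∀ i, 0 < Td i)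
    {q : Vec n} (hq : ∀ i, 0 < q i)
    {G : SimpleGraph (Fin n)} [DecidableRel G.Adj] (hG : G.Connected)
    {S2 : Matrix (Fin r) (Fin r) ℝ} {R2 : Fin r → ℝ}
    (hS2skew : S2ᵀ = -S2) (hS2inv : IsUnit S2.det) {r3 : Fin n → ℕ}
    {S3 : (i : Fin n) → Matrix (Fin (r3 i)) (Fin (r3 i)) ℝ} {R3 : (i : Fin n) → Fin (r3 i) → ℝ}
    (hS3skew : ∀ i, (S3 i)ᵀ = -(S3 i)) (hS3inv : ∀ i, IsUnit (S3 i).det)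
    (hobs : ∀ i, ∀ (x : Fin r → ℝ) (y : Fin (r3 i) → ℝ),
      (∀ j < r + r3 i, R2 ⬝ᵥ (S2 ^ j) *ᵥ x + R3 i ⬝ᵥ ((S3 i) ^ j) *ᵥ y = 0) →
      x = 0 ∧ y = 0) (ηb : Vec m) (Vb : Vec n) :
    Loop (Fin n) (Fin m) fun i => Fin r ⊕ Fin (r3 i) where
  toGrid := gridOf ep1 ep2 B Bii Xd Xd'
  inertia := Md
  damping := Ad
  timeConst := Td
  gain i := (q i)⁻¹
  weight i j := if G.Adj i j then 1 else 0
  exo i := fromBlocks S2 0 0 (S3 i)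
  out i := Sum.elim ((q i)⁻¹ • R2) (R3 i)
  ηb := ηb
  Vb := Vb
  src_ne_tgt := hep
  inertia_pos := hM
  damping_pos := hA
  timeConst_pos := hT
  gain_pos i := inv_pos.2 (hq i)
  weight_nonneg i j := by split_ifs <;> norm_num
  weight_symm i j := by simp only [G.adj_comm]
  weight_connected i j := by
    refine Relation.ReflTransGen.mono ?_ _ _
      ((SimpleGraph.reachable_iff_reflTransGen i j).1 (hG.preconnected i j))
    intro a b hab
    simp [hab]
  exo_skew i z := by
    refine self_eq_neg.1 ?_
    conv_lhs => rw [dotProduct_mulVec, ← mulVec_transpose, dotProduct_comm, fromBlocks_transpose,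
      hS2skew, hS3skew]
    rw [← dotProduct_neg, ← neg_mulVec, fromBlocks_neg]
    simp
  exo_injective i z hz := by
    refine eq_zero_of_mulVec_eq_zero ?_ hz
    rw [det_fromBlocks_zero₂₁]
    exact mul_ne_zero hS2inv.ne_zero (hS3inv i).ne_zero
  observable i z hz := by
    obtain ⟨h1, h2⟩ := hobs i ((q i)⁻¹ • (z ∘ Sum.inl)) (z ∘ Sum.inr) fun j hj => by
      have := hz j (by simpa using hj)
      rw [fromBlocks_diagonal_pow, fromBlocks_mulVec, sumElim_dotProduct_sumElim] at this
      simpa [mulVec_smul] using this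
    ext j
    rcases j with j | j
    · simpa [(hq i).ne'] using congrFun h1 j
    · simpa using congrFun h2 j

end

/-- Corollary 2: frequency regulation under demand
`Pˡ(t) = Π₁σ₁ + Q⁻¹1R₂σ₂(t) + R̄₃σ₃(t)` with node-dependent observable oscillatory
exosystems: solutions of the closed loop starting sufficiently close to the steady state
satisfy `ω(t) → 0` and `u(t) − ū(t) → 0`. -/
theorem frequency_regulation_wider_time_varying_demand
    {n m r : ℕ} (ep1 ep2 : Fin m → Fin n) (hep : ∀ k, ep1 k ≠ ep2 k)
    (B : Fin m → ℝ) (hB : ∀ k, 0 < B k)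
    (Bii Xd Xd' : Vec n)
    (Md Ad Td : Vec n) (hM : ∀ i, 0 < Md i) (hA : ∀ i, 0 < Ad i) (hT : ∀ i, 0 < Td i)
    (q : Vec n) (hq : ∀ i, 0 < q i)
    (G : SimpleGraph (Fin n)) [DecidableRel G.Adj] (hG : G.Connected)
    (Efd : Vec n)
    -- the exosystem generating the demand
    (π1 : Vec n) (σ1 : ℝ)
    (S2 : Matrix (Fin r) (Fin r) ℝ) (R2 : Fin r → ℝ)
    (hS2skew : S2ᵀ = -S2) (hS2inv : IsUnit S2.det)
    (r3 : Fin n → ℕ)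
    (S3 : (i : Fin n) → Matrix (Fin (r3 i)) (Fin (r3 i)) ℝ)
    (R3 : (i : Fin n) → Fin (r3 i) → ℝ)
    (hS3skew : ∀ i, (S3 i)ᵀ = -(S3 i)) (hS3inv : ∀ i, IsUnit (S3 i).det)
    -- observability of the pair `((R₂ R₃ᵢ), blockdiag(S₂, S₃ᵢ))` for every node `i`
    (hobs : ∀ i, ∀ (x : Fin r → ℝ) (y : Fin (r3 i) → ℝ),
      (∀ j < r + r3 i, R2 ⬝ᵥ (S2 ^ j).mulVec x + R3 i ⬝ᵥ ((S3 i) ^ j).mulVec y = 0) →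
      x = 0 ∧ y = 0)
    (σ2 : ℝ → Fin r → ℝ) (hσ2 : ∀ t, HasDerivAt σ2 (S2.mulVec (σ2 t)) t)
    (σ3 : ℝ → (i : Fin n) → Fin (r3 i) → ℝ)
    (hσ3 : ∀ t, HasDerivAt σ3 (fun i => (S3 i).mulVec (σ3 t i)) t)
    (Pl : ℝ → Vec n)
    (hPl : ∀ t, Pl t
      = fun i => π1 i * σ1 + (q i)⁻¹ * (R2 ⬝ᵥ σ2 t) + (R3 i ⬝ᵥ σ3 t i))
    -- the steady-state feedforward input
    (ubar : ℝ → Vec n)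
    (hubar : ∀ t, ubar t = fun i => (q i)⁻¹ * ((∑ j, π1 j * σ1) / (∑ j, (q j)⁻¹))
      + (q i)⁻¹ * (R2 ⬝ᵥ σ2 t) + (R3 i ⬝ᵥ σ3 t i))
    -- solution of the regulator equations (Assumptions 3 and 4)
    (ηb : Vec m) (hηbr : ∃ δ : Vec n, ηb = (incD ep1 ep2)ᵀ.mulVec δ)
    (Vb : Vec n) (hVb : ∀ i, 0 < Vb i)
    (hfeas : ∀ t, (fun i => ubar t i - Pl t i)
      = (incD ep1 ep2).mulVec ((Gam ep1 ep2 B Vb).mulVec (sinv ηb)))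
    (hEfd : (Emat ep1 ep2 B Bii Xd Xd' ηb).mulVec Vb = Efd)
    (hsec : ∀ k, ηb k ∈ Set.Ioo (-(π / 2)) (π / 2))
    (hPD : (Schur ep1 ep2 B Bii Xd Xd' ηb Vb).PosDef) :
    ∃ ε > (0:ℝ),
      ∀ (η : ℝ → Vec m) (ω ω' V V' θ1 : ℝ → Vec n) (θ2 : ℝ → Fin n → Fin r → ℝ)
        (θ3 : ℝ → (i : Fin n) → Fin (r3 i) → ℝ),
        (∀ t, HasDerivAt η ((incD ep1 ep2)ᵀ.mulVec (ω t)) t) →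
        (∀ t, HasDerivAt ω (ω' t) t) →
        (∀ t, (Matrix.diagonal Md).mulVec (ω' t)
          = (fun i => (q i)⁻¹ * θ1 t i + (q i)⁻¹ * (R2 ⬝ᵥ θ2 t i) + (R3 i ⬝ᵥ θ3 t i))
            - (incD ep1 ep2).mulVec ((Gam ep1 ep2 B (V t)).mulVec (sinv (η t)))
            - (Matrix.diagonal Ad).mulVec (ω t) - Pl t) →
        (∀ t, HasDerivAt V (V' t) t) →
        (∀ t, (Matrix.diagonal Td).mulVec (V' t)
          = -(Emat ep1 ep2 B Bii Xd Xd' (η t)).mulVec (V t) + Efd) →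
        (∀ t, HasDerivAt θ1
          (fun i => (∑ j, if G.Adj i j then θ1 t j - θ1 t i else 0)
            - (q i)⁻¹ * ω t i) t) →
        (∀ t, HasDerivAt θ2
          (fun i j => (S2.mulVec (θ2 t i)) j - (q i)⁻¹ * R2 j * ω t i) t) →
        (∀ t, HasDerivAt θ3
          (fun i => (S3 i).mulVec (θ3 t i) - fun j => R3 i j * ω t i) t) →
        (dist (η 0) ηb < ε ∧ dist (ω 0) 0 < ε ∧ dist (V 0) Vb < ε ∧
          dist (θ1 0) (fun _ => (∑ j, π1 j * σ1) / (∑ j, (q j)⁻¹)) < ε ∧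
          dist (θ2 0) (fun _ => σ2 0) < ε ∧ dist (θ3 0) (σ3 0) < ε) →
        Filter.Tendsto ω Filter.atTop (𝓝 0) ∧
        Filter.Tendsto
          (fun t => (fun i => (q i)⁻¹ * θ1 t i + (q i)⁻¹ * (R2 ⬝ᵥ θ2 t i)
            + (R3 i ⬝ᵥ θ3 t i)) - ubar t)
          Filter.atTop (𝓝 0) := by
  have hcos : ∀ k, 0 < cos (ηb k) := fun k => cos_pos_of_mem_Ioo (hsec k)
  let L := loopOf hep B Bii Xd Xd' hM hA hT hq hG hS2skew hS2inv hS3skew hS3inv hobs ηb Vb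
  obtain ⟨ε, hε, hL⟩ := L.exists_pos_forall_tendsto hB hVb hcos fun v hv => by
    have := hPD.dotProduct_mulVec_pos hv
    rwa [star_trivial, dotProduct_Schur_mulVec hep B Bii Xd Xd' hcos] at this
  refine ⟨ε, hε, fun η ω ω' V V' θ1 θ2 θ3 hη hω hωeq hV hVeq hθ1 hθ2 hθ3
    ⟨d1, d2, d3, d4, d5, d6⟩ => ?_⟩
  set s : ℝ := (∑ j, π1 j * σ1) / ∑ j, (q j)⁻¹ with hs
  let x : ℝ → Vec n := fun t i => θ1 t i - s
  let z : ℝ → (i : Fin n) → Fin r ⊕ Fin (r3 i) → ℝ := fun t i =>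
    Sum.elim (θ2 t i - σ2 t) (θ3 t i - σ3 t i)
  have hctl : ∀ t i, L.control (x t) (z t) i = ((q i)⁻¹ * θ1 t i + (q i)⁻¹ * (R2 ⬝ᵥ θ2 t i)
      + R3 i ⬝ᵥ θ3 t i) - ubar t i := by
    intro t i
    simp only [Loop.control, L, loopOf, x, z, sumElim_dotProduct_sumElim, smul_dotProduct,
      dotProduct_sub, smul_eq_mul, hubar t]
    ring
  have himb : ∀ t i, L.imbalance (η t) (V t) i
      = (incD ep1 ep2 *ᵥ (Gam ep1 ep2 B (V t) *ᵥ sinv (η t))) i - (ubar t i - Pl t i) := by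
    intro t i
    rw [congrFun (hfeas t) i, incD_mulVec_flow B Bii Xd Xd', incD_mulVec_flow B Bii Xd Xd',
      ← Finset.sum_sub_distrib]
    exact Finset.sum_congr rfl fun k _ => mul_sub _ _ _
  have htraj : L.IsTrajectory η V ω x z := by
    refine ⟨fun t k => ?_, fun t i => ?_, fun t i => ?_, fun t i => ?_, fun t i j => ?_⟩
    · exact (hasDerivAt_pi.1 (hη t) k).congr_deriv (incD_transpose_mulVec hep _ _)
    · refine (hasDerivAt_pi.1 (hV t) i).congr_deriv ?_
      have h1 := congrFun (hVeq t) i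
      rw [mulVec_diagonal, ← hEfd, Emat_mulVec hep, Emat_mulVec hep, Pi.add_apply, Pi.neg_apply]
        at h1
      rw [eq_inv_mul_iff_mul_eq₀ (L.timeConst_pos i).ne']
      refine h1.trans ?_
      rw [neg_add_eq_sub]
      rfl
    · refine (hasDerivAt_pi.1 (hω t) i).congr_deriv ?_
      have h1 := congrFun (hωeq t) i
      simp only [Pi.sub_apply, mulVec_diagonal] at h1
      rw [eq_inv_mul_iff_mul_eq₀ (L.inertia_pos i).ne', hctl, himb]
      refine h1.trans ?_
      change _ = _ - Ad i * ω t i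
      ring
    · refine ((hasDerivAt_pi.1 (hθ1 t) i).sub_const s).congr_deriv ?_
      simp [L, loopOf, x]
    · rcases j with j | j
      · refine ((hasDerivAt_pi.1 (hasDerivAt_pi.1 (hθ2 t) i) j).sub
          (hasDerivAt_pi.1 (hσ2 t) j)).congr_deriv ?_
        simp [L, loopOf, z, fromBlocks_mulVec, mulVec_sub]
        ring
      · refine ((hasDerivAt_pi.1 (hasDerivAt_pi.1 (hθ3 t) i) j).sub
          (hasDerivAt_pi.1 (hasDerivAt_pi.1 (hσ3 t) i) j)).congr_deriv ?_
        simp [L, loopOf, z, fromBlocks_mulVec, mulVec_sub]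
        ring
  have hx0 : dist (x 0) 0 < ε := by
    rw [dist_pi_lt_iff hε] at d4 ⊢
    intro i
    simpa [x, Real.dist_eq] using d4 i
  have hz0 : dist (z 0) 0 < ε := by
    simp only [dist_pi_lt_iff hε] at d5 d6 ⊢
    rintro i (j | j)
    · simpa [z, Real.dist_eq] using d5 i j
    · simpa [z, Real.dist_eq] using d6 i j
  have hlim := hL η V ω x z htraj d1 d3 d2 hx0 hz0
  refine ⟨tendsto_pi_nhds.2 fun i => (hlim i).1, tendsto_pi_nhds.2 fun i => ?_⟩
  exact (hlim i).2.congr fun t => hctl t i
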